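/- arXiv:1103.5605 — 7 statements merged into one kernel-verified Lean document; each statement's English description precedes it below -/
import Mathlib

section
/- If the right derivative R′₊(0) = lim_{u↓0} R(u)/u satisfies R′₊(0) ≤ 0 and R is not identically zero on [0,∞), then R(u) < 0 for every u > 0. -/
open MeasureTheory Filter Set
open scoped ENNReal Topology

/-- The integrand of the Lévy–Khintchine-type exponent, at the point `u`. -/
noncomputable def compensatedExp (u ξ : ℝ) : ℝ :=
  Real.exp (-(u * ξ)) - 1 + (if ξ ≤ 1 then u * ξ else 0)

lemma exp_neg_le_one_sub_add_sq {x : ℝ} (hx : 0 ≤ x) :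
    Real.exp (-x) ≤ 1 - x + x ^ 2 := by
  have h1 : 0 < Real.exp (-x) := Real.exp_pos _
  have h2 : Real.exp (-x) * Real.exp x = 1 := by rw [← Real.exp_add]; simp
  have h3 : Real.exp (-x) * (1 + x) ≤ 1 := by
    rw [← h2]
    gcongr
    linarith [Real.add_one_le_exp x]
  have h4 : 0 ≤ x ^ 3 := by positivity
  by_contra! h
  nlinarith

lemma abs_compensatedExp_le {u ξ : ℝ} (hu : 0 ≤ u) (hξ : 0 < ξ) :
    |compensatedExp u ξ| ≤ (u ^ 2 + 1) * min (ξ ^ 2) 1 := by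
  have hx : 0 ≤ u * ξ := by positivity
  have h0 := Real.exp_pos (-(u * ξ))
  rw [abs_le]
  unfold compensatedExp
  split_ifs with h
  · have h1 := exp_neg_le_one_sub_add_sq hx
    have h2 := Real.add_one_le_exp (-(u * ξ))
    rw [min_eq_left (by nlinarith : ξ ^ 2 ≤ 1)]
    constructor <;> nlinarith [sq_nonneg ξ, sq_nonneg (u * ξ)]
  · have h1 : Real.exp (-(u * ξ)) ≤ 1 := Real.exp_le_one_iff.2 (by linarith)
    rw [min_eq_right (by nlinarith : (1 : ℝ) ≤ ξ ^ 2)]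
    constructor <;> nlinarith [sq_nonneg u]

lemma integrable_compensatedExp {μ : Measure ℝ}
    (hμ : ∫⁻ ξ in Set.Ioi (0:ℝ), ENNReal.ofReal (min (ξ ^ 2) 1) ∂μ < ⊤) {u : ℝ} (hu : 0 ≤ u) :
    IntegrableOn (compensatedExp u) (Set.Ioi 0) μ := by
  have hmin : IntegrableOn (fun ξ : ℝ => min (ξ ^ 2) 1) (Set.Ioi 0) μ := by
    refine ⟨by fun_prop, ?_⟩
    rw [hasFiniteIntegral_iff_ofReal (ae_of_all _ fun ξ => by positivity)]
    exact hμ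
  have hmeas : Measurable (compensatedExp u) := by
    unfold compensatedExp
    exact (by fun_prop : Measurable fun ξ : ℝ => Real.exp (-(u * ξ)) - 1).add
      (Measurable.ite measurableSet_Iic (by fun_prop) measurable_const)
  refine (hmin.const_mul (u ^ 2 + 1)).mono' hmeas.aestronglyMeasurable ?_
  filter_upwards [ae_restrict_mem measurableSet_Ioi] with ξ hξ
  exact abs_compensatedExp_le hu hξ

lemma compensatedExp_sub_two_mul_half (u ξ : ℝ) :
    compensatedExp u ξ - 2 * compensatedExp (u / 2) ξ = (1 - Real.exp (-(u / 2 * ξ))) ^ 2 := by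
  have h : Real.exp (-(u * ξ)) = Real.exp (-(u / 2 * ξ)) ^ 2 := by
    rw [← Real.exp_nat_mul]
    congr 1
    push_cast
    ring
  unfold compensatedExp
  rw [h]
  split_ifs <;> ring

/-- A function with `f u ≤ 2 f (u / 2)` whose difference quotient at `0+` has a nonpositive limit
is nonpositive on the positive half-line. -/
lemma nonpos_of_le_two_mul_half {f : ℝ → ℝ} {ρ : EReal}
    (hlim : Tendsto (fun u => ((f u / u : ℝ) : EReal)) (𝓝[>] (0:ℝ)) (𝓝 ρ)) (hρ : ρ ≤ 0)
    (hf : ∀ u > (0:ℝ), f u ≤ 2 * f (u / 2)) {u : ℝ} (hu : 0 < u) : f u ≤ 0 := by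
  have hseq : Tendsto (fun n : ℕ => u / 2 ^ n) atTop (𝓝[>] (0:ℝ)) := by
    refine tendsto_nhdsWithin_iff.2 ⟨?_, Eventually.of_forall fun n => ?_⟩
    · exact tendsto_const_nhds.div_atTop (tendsto_pow_atTop_atTop_of_one_lt one_lt_two)
    · exact div_pos hu (by positivity)
  have hle : ∀ n : ℕ, f u / u ≤ f (u / 2 ^ n) / (u / 2 ^ n) := by
    intro n
    induction n with
    | zero => simp
    | succ n ih =>
      refine ih.trans ?_
      have hv : 0 < u / 2 ^ n := by positivity
      have h := hf _ hv
      have e : u / 2 ^ (n + 1) = u / 2 ^ n / 2 := by rw [pow_succ, div_div]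
      rw [e, div_le_div_iff₀ hv (by positivity)]
      nlinarith
  have h := (ge_of_tendsto (hlim.comp hseq)
    (Eventually.of_forall fun n => EReal.coe_le_coe_iff.2 (hle n))).trans hρ
  have h' : f u / u ≤ 0 := by exact_mod_cast h
  by_contra! hpos
  exact absurd (div_pos hpos hu) (not_lt.2 h')

/-- If the right derivative `R′₊(0) = lim_{u↓0} R(u)/u` (which exists in
`(−∞,∞]`) satisfies `R′₊(0) ≤ 0` and `R` is not identically zero on `[0,∞)`, then
`R(u) < 0` for every `u > 0`. -/
theorem stmt2 (α β : ℝ) (hα : 0 ≤ α) (μ : Measure ℝ)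
    (hμ : ∫⁻ ξ in Set.Ioi (0:ℝ), ENNReal.ofReal (min (ξ ^ 2) 1) ∂μ < ⊤)
    (R : ℝ → ℝ)
    (hR : ∀ u, R u = -α * u ^ 2 + β * u -
      ∫ ξ in Set.Ioi (0:ℝ),
        (Real.exp (-(u * ξ)) - 1 + (if ξ ≤ 1 then u * ξ else 0)) ∂μ)
    (ρ : EReal)
    (hlim : Tendsto (fun u => ((R u / u : ℝ) : EReal)) (𝓝[>] (0:ℝ)) (𝓝 ρ))
    (hρ : ρ ≤ 0)
    (hRne : ¬ ∀ u ≥ (0:ℝ), R u = 0) :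
    ∀ u > (0:ℝ), R u < 0 := by
  have hR' : ∀ u, R u = -α * u ^ 2 + β * u - ∫ ξ in Set.Ioi (0:ℝ), compensatedExp u ξ ∂μ := hR
  have hint : ∀ u > (0:ℝ),
      IntegrableOn (fun ξ => (1 - Real.exp (-(u / 2 * ξ))) ^ 2) (Set.Ioi 0) μ := by
    intro u hu
    simp_rw [← compensatedExp_sub_two_mul_half]
    exact (integrable_compensatedExp hμ hu.le).sub
      ((integrable_compensatedExp hμ (half_pos hu).le).const_mul 2)
  have hmid : ∀ u > (0:ℝ), R u - 2 * R (u / 2) =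
      -(α * u ^ 2 / 2) - ∫ ξ in Set.Ioi (0:ℝ), (1 - Real.exp (-(u / 2 * ξ))) ^ 2 ∂μ := by
    intro u hu
    simp_rw [← compensatedExp_sub_two_mul_half]
    rw [integral_sub (integrable_compensatedExp hμ hu.le)
      ((integrable_compensatedExp hμ (half_pos hu).le).const_mul 2), integral_const_mul,
      hR' u, hR' (u / 2)]
    ring
  have hnonneg : ∀ u : ℝ, 0 ≤ ∫ ξ in Set.Ioi (0:ℝ), (1 - Real.exp (-(u / 2 * ξ))) ^ 2 ∂μ :=
    fun u => integral_nonneg fun ξ => sq_nonneg _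
  have hle : ∀ u > (0:ℝ), R u ≤ 0 := fun u hu => by
    refine nonpos_of_le_two_mul_half hlim hρ (fun v hv => ?_) hu
    have := hmid v hv
    have := hnonneg v
    have : 0 ≤ α * v ^ 2 := by positivity
    linarith
  intro u hu
  refine lt_of_le_of_ne (hle u hu) fun h0 => hRne ?_
  have hm := hmid u hu
  have hi := hnonneg u
  have hh := hle (u / 2) (half_pos hu)
  have hα' : 0 ≤ α * u ^ 2 := by positivity
  have hα0 : α = 0 := by
    have : α * u ^ 2 = 0 := by linarith
    exact (mul_eq_zero.1 this).resolve_right (by positivity)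
  have hI : ∫ ξ in Set.Ioi (0:ℝ), (1 - Real.exp (-(u / 2 * ξ))) ^ 2 ∂μ = 0 := by linarith
  have hμ0 : μ.restrict (Set.Ioi (0:ℝ)) = 0 := by
    rw [← ae_eq_bot, ← eventually_false_iff_eq_bot]
    filter_upwards [(integral_eq_zero_iff_of_nonneg (fun ξ => sq_nonneg _) (hint u hu)).1 hI,
      ae_restrict_mem measurableSet_Ioi] with ξ h1 hξ
    have h2 : Real.exp (-(u / 2 * ξ)) < 1 :=
      Real.exp_lt_one_iff.2 (neg_lt_zero.2 (mul_pos (half_pos hu) hξ))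
    have h3 : 1 - Real.exp (-(u / 2 * ξ)) = 0 := pow_eq_zero_iff two_ne_zero |>.1 h1
    linarith
  have hlin : ∀ v, R v = β * v := fun v => by
    rw [hR' v, hμ0, hα0]
    simp
  have hβ : β = 0 := (mul_eq_zero.1 ((hlin u).symm.trans h0)).resolve_right hu.ne'
  intro v _
  rw [hlin, hβ, zero_mul]
end

section
/- If lim_{u↓0} R(u)/u > 0 (the limit possibly being +∞) and there exists v > 0 with R(v) < 0, then there exists a unique u₀ > 0 with R(u₀) = 0; moreover R(u) > 0 for u ∈ (0, u₀) and R(u) < 0 for u ∈ (u₀, ∞). -/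
open MeasureTheory Filter Set
open scoped ENNReal Topology

/-- The Lévy–Khintchine integrand `e^{-uξ} - 1 + uξ·1_{ξ ≤ 1}` is dominated by
`(u² + 1) min(ξ², 1)` for `u ≥ 0`, `ξ > 0`. -/
theorem abs_levyKhintchine_integrand_le {u ξ : ℝ} (hu : 0 ≤ u) (hξ : 0 < ξ) :
    |Real.exp (-(u * ξ)) - 1 + (if ξ ≤ 1 then u * ξ else 0)| ≤ (u ^ 2 + 1) * min (ξ ^ 2) 1 := by
  have hx : 0 ≤ u * ξ := by positivity
  have hlow : -(u * ξ) + 1 ≤ Real.exp (-(u * ξ)) := Real.add_one_le_exp _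
  split_ifs with h
  · rw [min_eq_left (by nlinarith), abs_of_nonneg (by linarith)]
    have hup : Real.exp (-(u * ξ)) ≤ 1 - u * ξ + (u * ξ) ^ 2 := by
      rw [Real.exp_neg]
      calc (Real.exp (u * ξ))⁻¹ ≤ (u * ξ + 1)⁻¹ :=
            inv_anti₀ (by linarith) (Real.add_one_le_exp _)
        _ ≤ 1 - u * ξ + (u * ξ) ^ 2 := by
            rw [inv_le_iff_one_le_mul₀ (by linarith)]
            nlinarith [pow_nonneg hx 3]
    nlinarith [sq_nonneg ξ]
  · rw [min_eq_right (by nlinarith), add_zero]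
    have h1 : Real.exp (-(u * ξ)) ≤ 1 := Real.exp_le_one_iff.2 (by linarith)
    rw [abs_of_nonpos (by linarith)]
    nlinarith [Real.exp_pos (-(u * ξ)), sq_nonneg u]

theorem integrableOn_levyKhintchine_integrand {μ : Measure ℝ}
    (hμ : ∫⁻ ξ in Set.Ioi (0:ℝ), ENNReal.ofReal (min (ξ ^ 2) 1) ∂μ < ⊤) {u : ℝ} (hu : 0 ≤ u) :
    IntegrableOn (fun ξ => Real.exp (-(u * ξ)) - 1 + (if ξ ≤ 1 then u * ξ else 0))
      (Set.Ioi 0) μ := by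
  have hmin : IntegrableOn (fun ξ : ℝ => min (ξ ^ 2) 1) (Set.Ioi 0) μ := by
    refine ⟨Measurable.aestronglyMeasurable (by fun_prop), ?_⟩
    rwa [hasFiniteIntegral_iff_ofReal (ae_of_all _ fun ξ => by positivity)]
  refine (hmin.const_mul (u ^ 2 + 1)).mono' (Measurable.aestronglyMeasurable ?_) ?_
  · exact (by fun_prop : Measurable fun ξ : ℝ => Real.exp (-(u * ξ)) - 1).add
      (Measurable.ite measurableSet_Iic (by fun_prop) measurable_const)
  · filter_upwards [ae_restrict_mem measurableSet_Ioi] with ξ hξ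
    exact abs_levyKhintchine_integrand_le hu hξ

theorem convexOn_integral_levyKhintchine {μ : Measure ℝ}
    (hμ : ∫⁻ ξ in Set.Ioi (0:ℝ), ENNReal.ofReal (min (ξ ^ 2) 1) ∂μ < ⊤) :
    ConvexOn ℝ (Set.Ici 0) fun u : ℝ => ∫ ξ in Set.Ioi (0:ℝ),
      (Real.exp (-(u * ξ)) - 1 + (if ξ ≤ 1 then u * ξ else 0)) ∂μ := by
  refine ⟨convex_Ici 0, fun x hx y hy a b ha hb hab => ?_⟩
  have hx' := (integrableOn_levyKhintchine_integrand hμ hx).const_mul a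
  have hy' := (integrableOn_levyKhintchine_integrand hμ hy).const_mul b
  simp only [smul_eq_mul]
  rw [← integral_const_mul, ← integral_const_mul, ← integral_add hx' hy']
  refine integral_mono (integrableOn_levyKhintchine_integrand hμ
    (convex_Ici 0 hx hy ha hb hab)) (hx'.add hy') fun ξ => ?_
  have h := convexOn_exp.2 (mem_univ (-(x * ξ))) (mem_univ (-(y * ξ))) ha hb hab
  simp only [smul_eq_mul] at h
  rw [show a * -(x * ξ) + b * -(y * ξ) = -((a * x + b * y) * ξ) by ring] at h
  beta_reduce
  split_ifs <;> linear_combination h + hab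

/-- A concave function on `(0, ∞)` that is positive at points arbitrarily close to `0` and
negative somewhere changes sign exactly once. -/
theorem ConcaveOn.exists_unique_sign_change {f : ℝ → ℝ} (hf : ConcaveOn ℝ (Set.Ioi 0) f)
    (hpos : ∀ u > (0:ℝ), ∃ ε ∈ Set.Ioo 0 u, 0 < f ε) (hv : ∃ v > (0:ℝ), f v < 0) :
    ∃ u₀ > (0:ℝ), f u₀ = 0 ∧ (∀ u ∈ Set.Ioo (0:ℝ) u₀, 0 < f u) ∧
      (∀ u ∈ Set.Ioi u₀, f u < 0) ∧ (∀ u > (0:ℝ), f u = 0 → u = u₀) := by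
  obtain ⟨v, hv0, hv⟩ := hv
  obtain ⟨ε, ⟨hε0, hεv⟩, hε⟩ := hpos v hv0
  have hcont : ContinuousOn f (Set.Icc ε v) :=
    (hf.continuousOn isOpen_Ioi).mono fun x hx => hε0.trans_le hx.1
  obtain ⟨u₀, ⟨hu₀, -⟩, hfu₀⟩ := intermediate_value_Icc' hεv.le hcont ⟨hv.le, hε.le⟩
  have hu₀0 : 0 < u₀ := hε0.trans_le hu₀
  have hleft : ∀ u ∈ Set.Ioo (0:ℝ) u₀, 0 < f u := by
    rintro u ⟨hu0, huu₀⟩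
    obtain ⟨δ, ⟨hδ0, hδu⟩, hδ⟩ := hpos u hu0
    have h := hf.slope_anti_adjacent (x := δ) (y := u) (z := u₀) hδ0 hu₀0 hδu huu₀
    rw [div_le_div_iff₀ (by linarith) (by linarith), hfu₀] at h
    by_contra! hneg
    nlinarith [mul_pos hδ (sub_pos.2 huu₀)]
  have hright : ∀ u ∈ Set.Ioi u₀, f u < 0 := by
    intro u hu
    rw [Set.mem_Ioi] at hu
    obtain ⟨δ, ⟨hδ0, hδu⟩, hδ⟩ := hpos u₀ hu₀0
    have h := hf.slope_anti_adjacent (x := δ) (y := u₀) (z := u) hδ0 (hu₀0.trans hu) hδu hu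
    rw [div_le_div_iff₀ (by linarith) (by linarith), hfu₀] at h
    by_contra! hneg
    nlinarith [mul_pos hδ (sub_pos.2 hu)]
  refine ⟨u₀, hu₀0, hfu₀, hleft, hright, fun u hu hfu => ?_⟩
  rcases lt_trichotomy u u₀ with h | h | h
  · exact absurd hfu (hleft u ⟨hu, h⟩).ne'
  · exact h
  · exact absurd hfu (hright u h).ne

/-- If `lim_{u↓0} R(u)/u > 0` (the limit, which exists in `(−∞,∞]`,
possibly being `+∞`) and `R(v) < 0` for some `v > 0`, then there is a unique `u₀ > 0`
with `R(u₀) = 0`; moreover `R > 0` on `(0,u₀)` and `R < 0` on `(u₀,∞)`. -/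
theorem stmt3 (α β : ℝ) (hα : 0 ≤ α) (μ : Measure ℝ)
    (hμ : ∫⁻ ξ in Set.Ioi (0:ℝ), ENNReal.ofReal (min (ξ ^ 2) 1) ∂μ < ⊤)
    (R : ℝ → ℝ)
    (hR : ∀ u, R u = -α * u ^ 2 + β * u -
      ∫ ξ in Set.Ioi (0:ℝ),
        (Real.exp (-(u * ξ)) - 1 + (if ξ ≤ 1 then u * ξ else 0)) ∂μ)
    (ρ : EReal)
    (hlim : Tendsto (fun u => ((R u / u : ℝ) : EReal)) (𝓝[>] (0:ℝ)) (𝓝 ρ))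
    (hρ : 0 < ρ)
    (hv : ∃ v > (0:ℝ), R v < 0) :
    ∃ u₀ > (0:ℝ), R u₀ = 0 ∧
      (∀ u ∈ Set.Ioo (0:ℝ) u₀, 0 < R u) ∧
      (∀ u ∈ Set.Ioi u₀, R u < 0) ∧
      (∀ u > (0:ℝ), R u = 0 → u = u₀) := by
  have hquad : ConcaveOn ℝ (Set.Ici 0) fun u : ℝ => -α * u ^ 2 + β * u := by
    refine ⟨convex_Ici 0, fun x _ y _ a b ha hb hab => ?_⟩
    obtain rfl : b = 1 - a := by linarith
    simp only [smul_eq_mul]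
    nlinarith [mul_nonneg (mul_nonneg hα (mul_nonneg ha hb)) (sq_nonneg (x - y))]
  have hconc : ConcaveOn ℝ (Set.Ioi 0) R := by
    rw [funext hR]
    exact (hquad.sub (convexOn_integral_levyKhintchine hμ)).subset Ioi_subset_Ici_self
      (convex_Ioi 0)
  refine hconc.exists_unique_sign_change (fun u hu => ?_) hv
  obtain ⟨ε, hε, hεu⟩ :=
    ((hlim.eventually (lt_mem_nhds hρ)).and (Ioo_mem_nhdsGT hu)).exists
  exact ⟨ε, hεu, (div_pos_iff_of_pos_right hεu.1).1 (EReal.coe_pos.1 hε)⟩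
end

section
/- Assume that ρ := lim_{u↓0} R(u)/u satisfies ρ < 0 (so in particular R(s) < 0 for all s > 0) and that ∫_(1,∞) log ξ m(dξ) < ∞. Then for every u > 0 the integral ∫_0^u F(s)/(−R(s)) ds is finite. -/
open MeasureTheory Filter Set
open scoped ENNReal Topology

/-- The integral of a nonnegative function is bounded by its lower Lebesgue integral, even
without integrability. -/
theorem ofReal_integral_le_lintegral {X : Type*} [MeasurableSpace X] {ν : Measure X} {f : X → ℝ}
    (hf : 0 ≤ᵐ[ν] f) (hfm : AEStronglyMeasurable f ν) :
    ENNReal.ofReal (∫ x, f x ∂ν) ≤ ∫⁻ x, ENNReal.ofReal (f x) ∂ν := by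
  rw [integral_eq_lintegral_of_nonneg_ae hf hfm]
  exact ENNReal.ofReal_toReal_le

/-- A measure which integrates an everywhere positive real function is s-finite. -/
theorem sFinite_of_lintegral_ofReal_lt_top {X : Type*} [MeasurableSpace X] {ν : Measure X}
    {f : X → ℝ} (hfm : Measurable f) (hpos : ∀ᵐ x ∂ν, 0 < f x)
    (hfin : ∫⁻ x, ENNReal.ofReal (f x) ∂ν < ⊤) : SFinite ν := by
  have hm : Measurable fun x => ENNReal.ofReal (f x) := hfm.ennreal_ofReal
  have : IsFiniteMeasure (ν.withDensity fun x => ENNReal.ofReal (f x)) :=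
    isFiniteMeasure_withDensity hfin.ne
  rw [← withDensity_inv_same hm (hpos.mono fun x hx => (ENNReal.ofReal_pos.2 hx).ne')
    (Eventually.of_forall fun _ => ENNReal.ofReal_ne_top)]
  infer_instance

/-- The Lévy–Khintchine integrand of a branching mechanism is integrable. -/
theorem integrableOn_exp_sub_one_add {μ : Measure ℝ}
    (hμ : ∫⁻ ξ in Ioi (0:ℝ), ENNReal.ofReal (min (ξ ^ 2) 1) ∂μ < ⊤) {u : ℝ} (hu : 0 ≤ u) :
    IntegrableOn (fun ξ : ℝ => Real.exp (-(u * ξ)) - 1 + (if ξ ≤ 1 then u * ξ else 0))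
      (Ioi 0) μ := by
  have hdom : IntegrableOn (fun ξ : ℝ => min (ξ ^ 2) 1) (Ioi 0) μ := by
    refine ⟨by fun_prop, ?_⟩
    rw [hasFiniteIntegral_iff_ofReal (Eventually.of_forall fun ξ => by positivity)]
    exact hμ
  refine (hdom.const_mul (u ^ 2 + 1)).mono' ?_ ?_
  · refine Measurable.aestronglyMeasurable ?_
    refine Measurable.add (by fun_prop) (Measurable.ite measurableSet_Iic ?_ ?_) <;> fun_prop
  · filter_upwards [ae_restrict_mem measurableSet_Ioi] with ξ hξ
    have hξ : 0 < ξ := hξ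
    have hx : 0 ≤ u * ξ := by positivity
    have h1 : Real.exp (-(u * ξ)) ≤ 1 := Real.exp_le_one_iff.2 (by linarith)
    have h2 := Real.add_one_le_exp (-(u * ξ))
    have h3 := Real.exp_pos (-(u * ξ))
    split_ifs with h
    · rw [min_eq_left (by nlinarith), Real.norm_eq_abs, abs_of_nonneg (by linarith)]
      have h4 : Real.exp (-(u * ξ)) ≤ 1 - u * ξ + (u * ξ) ^ 2 := by
        have h5 := Real.add_one_le_exp (u * ξ)
        have h6 : Real.exp (-(u * ξ)) * Real.exp (u * ξ) = 1 := by
          rw [← Real.exp_add]; simp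
        have h7 : Real.exp (-(u * ξ)) * (u * ξ + 1) ≤ 1 := by nlinarith
        have h8 : 1 ≤ (1 - u * ξ + (u * ξ) ^ 2) * (u * ξ + 1) := by
          nlinarith [pow_nonneg hx 3]
        exact le_of_mul_le_mul_right (h7.trans h8) (by linarith)
      nlinarith [sq_nonneg ξ]
    · rw [min_eq_right (by nlinarith), Real.norm_eq_abs, abs_le]
      constructor <;> nlinarith [sq_nonneg u]

/-- Convexity of the Lévy–Khintchine integrand along a ray from the origin. -/
theorem exp_sub_one_add_le_mul {s t ξ : ℝ} (ht : 0 < t) (hts : t ≤ s) :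
    Real.exp (-(t * ξ)) - 1 + (if ξ ≤ 1 then t * ξ else 0) ≤
      t / s * (Real.exp (-(s * ξ)) - 1 + (if ξ ≤ 1 then s * ξ else 0)) := by
  have hs : 0 < s := ht.trans_le hts
  have hc : t / s ≤ 1 := (div_le_one hs).2 hts
  have hconv := convexOn_exp.2 (mem_univ (-(s * ξ))) (mem_univ 0) (by positivity : 0 ≤ t / s)
    (sub_nonneg.2 hc) (by ring)
  have heq : t / s * (s * ξ) = t * ξ := by field_simp
  simp only [smul_eq_mul, mul_zero, add_zero, Real.exp_zero, mul_one, mul_neg, heq] at hconv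
  split_ifs
  · rw [mul_add, heq]; linarith
  · linarith

/-- The jump part of `F(s)/s`, integrated in `s` for a single jump size `ξ`, grows at most
logarithmically in `ξ`. -/
theorem lintegral_one_sub_exp_div_le {U ξ : ℝ} (hU : 1 ≤ U) (hξ : 0 < ξ) :
    ∫⁻ s in Ioo (0:ℝ) U, ENNReal.ofReal ((1 - Real.exp (-(s * ξ))) / s) ≤
      ENNReal.ofReal (U + 1 + Real.log U) * ENNReal.ofReal (min ξ 1) +
        (Ioi 1).indicator (fun ξ => ENNReal.ofReal (Real.log ξ)) ξ := by
  have hlogU := Real.log_nonneg hU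
  have hbound : ∀ s : ℝ, 0 < s → (1 - Real.exp (-(s * ξ))) / s ≤ ξ := fun s hs => by
    rw [div_le_iff₀ hs]
    linarith [Real.add_one_le_exp (-(s * ξ))]
  have hconst : ∀ a : ℝ, ∫⁻ s in Ioc 0 a, ENNReal.ofReal ((1 - Real.exp (-(s * ξ))) / s) ≤
      ENNReal.ofReal (ξ * a) := fun a => by
    refine (setLIntegral_mono measurable_const fun s hs =>
      ENNReal.ofReal_le_ofReal (hbound s hs.1)).trans ?_
    rw [setLIntegral_const, Real.volume_Ioc, sub_zero, ENNReal.ofReal_mul hξ.le]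
  rcases le_or_gt ξ 1 with h | h
  · refine ((lintegral_mono_set Ioo_subset_Ioc_self).trans (hconst U)).trans ?_
    refine le_trans ?_ le_self_add
    rw [min_eq_left h, ← ENNReal.ofReal_mul (by linarith)]
    exact ENNReal.ofReal_le_ofReal (by nlinarith)
  · have hi : 0 < 1 / ξ := by positivity
    have hi1 : 1 / ξ ≤ 1 := (div_le_one hξ).2 h.le
    have hlogξ := Real.log_nonneg h.le
    have htail : ∫⁻ s in Ioc (1 / ξ) U, ENNReal.ofReal ((1 - Real.exp (-(s * ξ))) / s) ≤
        ENNReal.ofReal (Real.log U + Real.log ξ) := by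
      have hint : IntegrableOn (fun s : ℝ => 1 / s) (Ioc (1 / ξ) U) := by
        rw [← intervalIntegrable_iff_integrableOn_Ioc_of_le (hi1.trans hU)]
        refine intervalIntegral.intervalIntegrable_one_div (fun x hx => ?_) continuousOn_id
        rw [uIcc_of_le (hi1.trans hU)] at hx
        exact (hi.trans_le hx.1).ne'
      refine (setLIntegral_mono (g := fun s => ENNReal.ofReal (1 / s)) (by fun_prop)
        fun s hs => ENNReal.ofReal_le_ofReal ?_).trans ?_
      · have hs0 : 0 < s := hi.trans hs.1
        gcongr
        linarith [Real.exp_pos (-(s * ξ))]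
      · rw [← ofReal_integral_eq_lintegral_ofReal hint
          ((ae_restrict_mem measurableSet_Ioc).mono fun s hs =>
            one_div_nonneg.2 (hi.trans hs.1).le),
          ← intervalIntegral.integral_of_le (hi1.trans hU),
          integral_one_div_of_pos hi (by linarith), div_div_eq_mul_div, div_one,
          Real.log_mul (by linarith) hξ.ne']
    rw [min_eq_right h.le, indicator_of_mem (mem_Ioi.2 h), ENNReal.ofReal_one, mul_one,
      ← ENNReal.ofReal_add (by linarith) hlogξ]
    calc
      _ ≤ ∫⁻ s in Ioc 0 (1 / ξ) ∪ Ioc (1 / ξ) U,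
          ENNReal.ofReal ((1 - Real.exp (-(s * ξ))) / s) := by
        refine lintegral_mono_set ?_
        rw [Ioc_union_Ioc_eq_Ioc hi.le (hi1.trans hU)]
        exact Ioo_subset_Ioc_self
      _ ≤ ENNReal.ofReal (ξ * (1 / ξ)) + ENNReal.ofReal (Real.log U + Real.log ξ) :=
        (lintegral_union_le _ _ _).trans (add_le_add (hconst _) htail)
      _ ≤ _ := by
        rw [mul_one_div_cancel hξ.ne', ← ENNReal.ofReal_add zero_le_one (by linarith)]
        exact ENNReal.ofReal_le_ofReal (by linarith)

/-- The log-moment condition makes the jump part of `F(s)/s` integrable near zero. -/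
theorem lintegral_lintegral_one_sub_exp_div_lt_top {m : Measure ℝ}
    (hm : ∫⁻ ξ in Ioi (0:ℝ), ENNReal.ofReal (min ξ 1) ∂m < ⊤)
    (hlog : ∫⁻ ξ in Ioi (1:ℝ), ENNReal.ofReal (Real.log ξ) ∂m < ⊤) {U : ℝ} (hU : 1 ≤ U) :
    ∫⁻ s in Ioo (0:ℝ) U, ∫⁻ ξ in Ioi (0:ℝ),
      ENNReal.ofReal ((1 - Real.exp (-(s * ξ))) / s) ∂m < ⊤ := by
  have : SFinite (m.restrict (Ioi 0)) :=
    sFinite_of_lintegral_ofReal_lt_top (by fun_prop)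
      ((ae_restrict_mem measurableSet_Ioi).mono fun ξ hξ => lt_min hξ one_pos) hm
  rw [lintegral_lintegral_swap (by fun_prop)]
  refine (setLIntegral_mono' measurableSet_Ioi fun ξ hξ =>
    lintegral_one_sub_exp_div_le hU hξ).trans_lt ?_
  rw [lintegral_add_left (by fun_prop), lintegral_const_mul _ (by fun_prop),
    lintegral_indicator measurableSet_Ioi, Measure.restrict_restrict measurableSet_Ioi,
    inter_eq_left.2 (Ioi_subset_Ioi zero_le_one)]
  exact ENNReal.add_lt_top.2 ⟨ENNReal.mul_lt_top ENNReal.ofReal_lt_top hm, hlog⟩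

open scoped ENNReal Topology

/-- If `ρ = lim_{u↓0} R(u)/u < 0` (so in particular `R(s) < 0` for all
`s > 0`) and the log-moment condition `∫_(1,∞) log ξ m(dξ) < ∞` holds, then for every
`u > 0` the integral `∫_0^u F(s)/(−R(s)) ds` is finite. -/
theorem stmt4 (b : ℝ) (hb : 0 ≤ b) (m : Measure ℝ)
    (hm : ∫⁻ ξ in Set.Ioi (0:ℝ), ENNReal.ofReal (min ξ 1) ∂m < ⊤)
    (F : ℝ → ℝ)
    (hF : ∀ u, F u = b * u - ∫ ξ in Set.Ioi (0:ℝ), (Real.exp (-(u * ξ)) - 1) ∂m)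
    (α β : ℝ) (hα : 0 ≤ α) (μ : Measure ℝ)
    (hμ : ∫⁻ ξ in Set.Ioi (0:ℝ), ENNReal.ofReal (min (ξ ^ 2) 1) ∂μ < ⊤)
    (R : ℝ → ℝ)
    (hR : ∀ u, R u = -α * u ^ 2 + β * u -
      ∫ ξ in Set.Ioi (0:ℝ),
        (Real.exp (-(u * ξ)) - 1 + (if ξ ≤ 1 then u * ξ else 0)) ∂μ)
    (ρ : ℝ)
    (hlim : Tendsto (fun u => R u / u) (𝓝[>] (0:ℝ)) (𝓝 ρ))
    (hρ : ρ < 0)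
    (hRneg : ∀ s > (0:ℝ), R s < 0)
    (hlog : ∫⁻ ξ in Set.Ioi (1:ℝ), ENNReal.ofReal (Real.log ξ) ∂m < ⊤) :
    ∀ u > (0:ℝ), ∫⁻ s in Set.Ioo (0:ℝ) u, ENNReal.ofReal (F s / (-R s)) < ⊤ := by
  have hray : ∀ s t, 0 < t → t ≤ s → t / s * R s ≤ R t := by
    intro s t ht hts
    have hs : 0 < s := ht.trans_le hts
    have hle := integral_mono (integrableOn_exp_sub_one_add hμ ht.le)
      ((integrableOn_exp_sub_one_add hμ hs.le).const_mul (t / s))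
      fun ξ => exp_sub_one_add_le_mul ht hts
    rw [integral_const_mul] at hle
    have hquad : t / s * (-α * s ^ 2 + β * s) ≤ -α * t ^ 2 + β * t := by
      have heq : t / s * (-α * s ^ 2 + β * s) = -α * (t * s) + β * t := by field_simp
      have hmul := mul_le_mul_of_nonneg_left (mul_le_mul_of_nonneg_left hts ht.le) hα
      rw [heq]
      linarith
    rw [hR s, hR t, mul_sub]
    linarith
  have hRle : ∀ s, 0 < s → R s ≤ ρ * s := by
    intro s hs
    rw [← div_le_iff₀ hs]
    refine ge_of_tendsto hlim ?_
    filter_upwards [Ioc_mem_nhdsGT hs] with t ht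
    rw [le_div_iff₀ ht.1]
    linarith [hray s t ht.1 ht.2, show R s / s * t = t / s * R s by ring]
  have hpoint : ∀ s, 0 < s → ENNReal.ofReal (F s / (-R s)) ≤
      ENNReal.ofReal (1 / -ρ) * (ENNReal.ofReal b +
        ∫⁻ ξ in Ioi (0:ℝ), ENNReal.ofReal ((1 - Real.exp (-(s * ξ))) / s) ∂m) := by
    intro s hs
    have hnonneg : ∀ ξ ∈ Ioi (0:ℝ), 0 ≤ (1 - Real.exp (-(s * ξ))) / s := fun ξ hξ =>
      div_nonneg (sub_nonneg.2 (Real.exp_le_one_iff.2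
        (neg_nonpos.2 (mul_pos hs hξ).le))) hs.le
    have hFs : F s / s = b + ∫ ξ in Ioi (0:ℝ), (1 - Real.exp (-(s * ξ))) / s ∂m := by
      rw [integral_div, hF s, sub_eq_add_neg, ← integral_neg]
      simp only [neg_sub]
      field_simp
    have hI : 0 ≤ ∫ ξ in Ioi (0:ℝ), (1 - Real.exp (-(s * ξ))) / s ∂m :=
      setIntegral_nonneg measurableSet_Ioi hnonneg
    have hdiv : 0 ≤ F s / s := hFs ▸ add_nonneg hb hI
    have hF0 : 0 ≤ F s := by simpa [hs.ne'] using mul_nonneg hdiv hs.le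
    have hρs : 0 < -ρ * s := mul_pos (neg_pos.2 hρ) hs
    have hle : F s / (-R s) ≤ 1 / -ρ * (F s / s) := by
      rw [div_mul_div_comm, one_mul]
      exact div_le_div_of_nonneg_left hF0 hρs (by linarith [hRle s hs])
    refine (ENNReal.ofReal_le_ofReal hle).trans ?_
    rw [ENNReal.ofReal_mul (one_div_nonneg.2 (neg_pos.2 hρ).le), hFs, ENNReal.ofReal_add hb hI]
    gcongr
    exact ofReal_integral_le_lintegral ((ae_restrict_mem measurableSet_Ioi).mono hnonneg)
      (Measurable.aestronglyMeasurable (by fun_prop))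
  intro u _
  refine (lintegral_mono_set (Ioo_subset_Ioo_right (le_max_left u 1))).trans_lt ?_
  refine (setLIntegral_mono' measurableSet_Ioo fun s hs => hpoint s hs.1).trans_lt ?_
  rw [lintegral_const_mul' _ _ ENNReal.ofReal_ne_top, lintegral_add_left measurable_const,
    setLIntegral_const, Real.volume_Ioo]
  exact ENNReal.mul_lt_top ENNReal.ofReal_lt_top (ENNReal.add_lt_top.2
    ⟨ENNReal.mul_lt_top ENNReal.ofReal_lt_top ENNReal.ofReal_lt_top,
      lintegral_lintegral_one_sub_exp_div_lt_top hm hlog (le_max_right u 1)⟩)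
end

section
/- Assume that ρ := lim_{u↓0} R(u)/u satisfies ρ < 0 (so in particular R(s) < 0 for all s > 0) and that ∫_(1,∞) log ξ m(dξ) = ∞. Then for every u > 0 the integral ∫_0^u F(s)/(−R(s)) ds is infinite. -/
open MeasureTheory Filter Set
open scoped ENNReal Topology

theorem integrableOn_min_one {m : Measure ℝ}
    (hm : ∫⁻ ξ in Set.Ioi (0:ℝ), ENNReal.ofReal (min ξ 1) ∂m < ⊤) :
    IntegrableOn (fun ξ : ℝ => min ξ 1) (Set.Ioi 0) m := by
  refine ⟨by fun_prop, ?_⟩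
  rw [hasFiniteIntegral_iff_ofReal]
  · exact hm
  · filter_upwards [ae_restrict_mem measurableSet_Ioi] with ξ hξ
    exact le_min (le_of_lt hξ) zero_le_one

theorem integrableOn_one_sub_exp_neg_mul {m : Measure ℝ}
    (hm : ∫⁻ ξ in Set.Ioi (0:ℝ), ENNReal.ofReal (min ξ 1) ∂m < ⊤)
    {s : ℝ} (hs : 0 ≤ s) (hs1 : s ≤ 1) :
    IntegrableOn (fun ξ : ℝ => 1 - Real.exp (-(s * ξ))) (Set.Ioi 0) m := by
  refine (integrableOn_min_one hm).mono' (by fun_prop) ?_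
  filter_upwards [ae_restrict_mem measurableSet_Ioi] with ξ hξ
  have hξ : 0 < ξ := hξ
  have h1 : Real.exp (-(s * ξ)) ≤ 1 := Real.exp_le_one_iff.2 (by nlinarith)
  rw [Real.norm_of_nonneg (by linarith)]
  refine le_min ?_ (by linarith [Real.exp_pos (-(s * ξ))])
  nlinarith [Real.add_one_le_exp (-(s * ξ))]

theorem measure_Ioi_one_lt_top {m : Measure ℝ}
    (hm : ∫⁻ ξ in Set.Ioi (0:ℝ), ENNReal.ofReal (min ξ 1) ∂m < ⊤) :
    m (Set.Ioi 1) < ⊤ := by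
  refine lt_of_le_of_lt ?_ hm
  calc m (Set.Ioi 1) = ∫⁻ _ in Set.Ioi (1:ℝ), 1 ∂m := by simp
    _ ≤ ∫⁻ ξ in Set.Ioi (1:ℝ), ENNReal.ofReal (min ξ 1) ∂m := by
        refine setLIntegral_mono' measurableSet_Ioi fun ξ hξ => ?_
        rw [min_eq_right (le_of_lt hξ)]
        simp
    _ ≤ _ := lintegral_mono_set (Set.Ioi_subset_Ioi zero_le_one)

/-- The inner integral of the Tonelli argument dominates a logarithm. -/
theorem ofReal_log_le_lintegral {C δ ξ : ℝ} (hC : 0 < C) (hδ : 0 < δ) (hξ : 0 < ξ) :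
    ENNReal.ofReal ((1 - Real.exp (-1)) / C * (Real.log ξ + Real.log δ)) ≤
      ∫⁻ s in Set.Ioo (0:ℝ) δ, ENNReal.ofReal ((1 - Real.exp (-(s * ξ))) / (C * s)) := by
  have he : 0 < 1 - Real.exp (-1) := by
    linarith [Real.exp_lt_one_iff.2 (show (-1:ℝ) < 0 by norm_num)]
  set c := (1 - Real.exp (-1)) / C with hc
  have hc0 : 0 < c := div_pos he hC
  rw [← Real.log_mul hξ.ne' hδ.ne']
  rcases le_total (ξ * δ) 1 with h | h
  · rw [ENNReal.ofReal_of_nonpos]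
    · exact zero_le
    · exact mul_nonpos_of_nonneg_of_nonpos hc0.le
        (Real.log_nonpos (by positivity) h)
  have hle : ξ⁻¹ ≤ δ := by
    rw [inv_le_iff_one_le_mul₀ hξ]
    linarith
  have hξi : 0 < ξ⁻¹ := inv_pos.2 hξ
  have hint : IntervalIntegrable (fun s : ℝ => c * s⁻¹) volume ξ⁻¹ δ := by
    refine (ContinuousOn.intervalIntegrable ?_)
    refine continuousOn_const.mul (continuousOn_inv₀.mono fun x hx => ?_)
    rw [Set.uIcc_of_le hle] at hx
    exact (lt_of_lt_of_le hξi hx.1).ne'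
  have heq : ∫ s in ξ⁻¹..δ, c * s⁻¹ = c * Real.log (ξ * δ) := by
    rw [intervalIntegral.integral_const_mul, integral_inv_of_pos hξi hδ]
    congr 2
    field_simp
  rw [← heq, intervalIntegral.integral_of_le hle, ofReal_integral_eq_lintegral_ofReal]
  · rw [setLIntegral_congr Ioo_ae_eq_Ioc.symm]
    refine (setLIntegral_mono' measurableSet_Ioo fun s hs => ?_).trans
      (lintegral_mono_set (Set.Ioo_subset_Ioo_left hξi.le))
    have hs0 : 0 < s := hξi.trans hs.1
    have h1 : 1 ≤ s * ξ := by
      rw [← inv_le_iff_one_le_mul₀ hξ]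
      exact hs.1.le
    refine ENNReal.ofReal_le_ofReal ?_
    rw [hc, ← div_eq_mul_inv, div_div]
    gcongr
  · exact hint.1
  · filter_upwards [ae_restrict_mem measurableSet_Ioc] with s hs
    exact mul_nonneg hc0.le (inv_nonneg.2 (hξi.trans hs.1).le)

theorem lintegral_log_add_const_eq_top {m : Measure ℝ} (hfin : m (Set.Ioi 1) < ⊤)
    (hlog : ∫⁻ ξ in Set.Ioi (1:ℝ), ENNReal.ofReal (Real.log ξ) ∂m = ⊤)
    {c : ℝ} (hc : 0 < c) (a : ℝ) :
    ∫⁻ ξ in Set.Ioi (1:ℝ), ENNReal.ofReal (c * (Real.log ξ + a)) ∂m = ⊤ := by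
  simp_rw [ENNReal.ofReal_mul hc.le]
  rw [lintegral_const_mul _ (by fun_prop)]
  refine ENNReal.mul_eq_top.2 (Or.inl ⟨by simpa using hc, ?_⟩)
  by_contra hne
  have hle : ∫⁻ ξ in Set.Ioi (1:ℝ), ENNReal.ofReal (Real.log ξ) ∂m ≤
      ∫⁻ ξ in Set.Ioi (1:ℝ), ENNReal.ofReal (Real.log ξ + a) ∂m +
        ENNReal.ofReal (-a) * m (Set.Ioi 1) := by
    rw [← setLIntegral_const, ← lintegral_add_right _ measurable_const]
    refine lintegral_mono fun ξ => ?_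
    refine le_trans (ENNReal.ofReal_le_ofReal ?_) ENNReal.ofReal_add_le
    linarith
  rw [hlog, top_le_iff, ENNReal.add_eq_top] at hle
  exact hle.elim hne (ENNReal.mul_ne_top ENNReal.ofReal_ne_top hfin.ne)

/-- The pure-jump part of the integrand bounds it from below where `-R s ≤ C * s`. -/
theorem lintegral_le_ofReal_div {b : ℝ} (hb : 0 ≤ b) {m : Measure ℝ}
    (hm : ∫⁻ ξ in Set.Ioi (0:ℝ), ENNReal.ofReal (min ξ 1) ∂m < ⊤)
    {C s r : ℝ} (hs : 0 < s) (hs1 : s ≤ 1) (hr : 0 < r) (hrC : r ≤ C * s) :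
    ∫⁻ ξ in Set.Ioi (1:ℝ), ENNReal.ofReal ((1 - Real.exp (-(s * ξ))) / (C * s)) ∂m ≤
      ENNReal.ofReal ((b * s - ∫ ξ in Set.Ioi (0:ℝ), (Real.exp (-(s * ξ)) - 1) ∂m) / r) := by
  have hint := integrableOn_one_sub_exp_neg_mul hm hs.le hs1
  have hsub : Set.Ioi (1:ℝ) ⊆ Set.Ioi 0 := Set.Ioi_subset_Ioi zero_le_one
  have hnn : ∀ ξ ∈ Set.Ioi (0:ℝ), 0 ≤ 1 - Real.exp (-(s * ξ)) := fun ξ hξ =>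
    sub_nonneg.2 (Real.exp_le_one_iff.2 (neg_nonpos.2 (mul_pos hs hξ).le))
  have hCs : 0 < C * s := hr.trans_le hrC
  rw [← ofReal_integral_eq_lintegral_ofReal ((hint.mono_set hsub).div_const _)]
  · refine ENNReal.ofReal_le_ofReal ?_
    rw [integral_div]
    have hneg : ∫ ξ in Set.Ioi (0:ℝ), (Real.exp (-(s * ξ)) - 1) ∂m =
        -∫ ξ in Set.Ioi (0:ℝ), (1 - Real.exp (-(s * ξ))) ∂m := by
      rw [← integral_neg]
      simp
    have hmono : ∫ ξ in Set.Ioi (1:ℝ), (1 - Real.exp (-(s * ξ))) ∂m ≤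
        ∫ ξ in Set.Ioi (0:ℝ), (1 - Real.exp (-(s * ξ))) ∂m :=
      setIntegral_mono_set hint
        ((ae_restrict_mem measurableSet_Ioi).mono hnn) hsub.eventuallyLE
    have h0 : 0 ≤ ∫ ξ in Set.Ioi (1:ℝ), (1 - Real.exp (-(s * ξ))) ∂m :=
      setIntegral_nonneg measurableSet_Ioi fun ξ hξ => hnn ξ (hsub hξ)
    have hbs : 0 ≤ b * s := mul_nonneg hb hs.le
    rw [hneg]
    exact div_le_div₀ (by linarith) (by linarith) hr hrC
  · filter_upwards [ae_restrict_mem measurableSet_Ioi] with ξ hξ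
    exact div_nonneg (hnn ξ (hsub hξ)) hCs.le

/-- If `ρ = lim_{u↓0} R(u)/u < 0` (so in particular `R(s) < 0` for all
`s > 0`) and the log-moment condition `∫_(1,∞) log ξ m(dξ) = ∞` holds, then for every
`u > 0` the integral `∫_0^u F(s)/(−R(s)) ds` is infinite. -/
theorem stmt5 (b : ℝ) (hb : 0 ≤ b) (m : Measure ℝ)
    (hm : ∫⁻ ξ in Set.Ioi (0:ℝ), ENNReal.ofReal (min ξ 1) ∂m < ⊤)
    (F : ℝ → ℝ)
    (hF : ∀ u, F u = b * u - ∫ ξ in Set.Ioi (0:ℝ), (Real.exp (-(u * ξ)) - 1) ∂m)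
    (α β : ℝ) (hα : 0 ≤ α) (μ : Measure ℝ)
    (hμ : ∫⁻ ξ in Set.Ioi (0:ℝ), ENNReal.ofReal (min (ξ ^ 2) 1) ∂μ < ⊤)
    (R : ℝ → ℝ)
    (hR : ∀ u, R u = -α * u ^ 2 + β * u -
      ∫ ξ in Set.Ioi (0:ℝ),
        (Real.exp (-(u * ξ)) - 1 + (if ξ ≤ 1 then u * ξ else 0)) ∂μ)
    (ρ : ℝ)
    (hlim : Tendsto (fun u => R u / u) (𝓝[>] (0:ℝ)) (𝓝 ρ))
    (hρ : ρ < 0)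
    (hRneg : ∀ s > (0:ℝ), R s < 0)
    (hlog : ∫⁻ ξ in Set.Ioi (1:ℝ), ENNReal.ofReal (Real.log ξ) ∂m = ⊤) :
    ∀ u > (0:ℝ), ∫⁻ s in Set.Ioo (0:ℝ) u, ENNReal.ofReal (F s / (-R s)) = ⊤ := by
  intro u hu
  have hC : 0 < 1 - ρ := by linarith
  obtain ⟨ε, hε, hεR⟩ : ∃ ε > (0:ℝ), ∀ s ∈ Set.Ioo 0 ε, -R s ≤ (1 - ρ) * s := by
    have hev : ∀ᶠ s in 𝓝[>] (0:ℝ), ρ - 1 < R s / s := hlim.eventually_const_lt (by linarith)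
    obtain ⟨ε, hε, h⟩ := mem_nhdsGT_iff_exists_Ioo_subset.1 hev
    refine ⟨ε, hε, fun s hs => ?_⟩
    have := (lt_div_iff₀ hs.1).1 (h hs)
    linarith
  set δ := min u (min 1 ε) with hδ_def
  have hδ : 0 < δ := lt_min hu (lt_min one_pos hε)
  have hfin := measure_Ioi_one_lt_top hm
  have : IsFiniteMeasure (m.restrict (Set.Ioi 1)) := ⟨by simpa using hfin⟩
  have hc : 0 < (1 - Real.exp (-1)) / (1 - ρ) :=
    div_pos (by linarith [Real.exp_lt_one_iff.2 (show (-1:ℝ) < 0 by norm_num)]) hC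
  rw [← top_le_iff]
  calc ⊤ = ∫⁻ ξ in Set.Ioi (1:ℝ), ENNReal.ofReal
          ((1 - Real.exp (-1)) / (1 - ρ) * (Real.log ξ + Real.log δ)) ∂m :=
        (lintegral_log_add_const_eq_top hfin hlog hc _).symm
    _ ≤ ∫⁻ ξ in Set.Ioi (1:ℝ), (∫⁻ s in Set.Ioo (0:ℝ) δ,
          ENNReal.ofReal ((1 - Real.exp (-(s * ξ))) / ((1 - ρ) * s))) ∂m :=
        setLIntegral_mono' measurableSet_Ioi fun ξ hξ =>
          ofReal_log_le_lintegral hC hδ (zero_lt_one.trans hξ)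
    _ = ∫⁻ s in Set.Ioo (0:ℝ) δ, (∫⁻ ξ in Set.Ioi (1:ℝ),
          ENNReal.ofReal ((1 - Real.exp (-(s * ξ))) / ((1 - ρ) * s)) ∂m) :=
        lintegral_lintegral_swap (Measurable.aemeasurable (by fun_prop))
    _ ≤ ∫⁻ s in Set.Ioo (0:ℝ) δ, ENNReal.ofReal (F s / (-R s)) := by
        refine setLIntegral_mono' measurableSet_Ioo fun s hs => ?_
        rw [hF]
        have hs' := lt_min_iff.1 (lt_min_iff.1 hs.2).2
        exact lintegral_le_ofReal_div hb hm hs.1 hs'.1.le (neg_pos.2 (hRneg s hs.1))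
          (hεR s ⟨hs.1, hs'.2⟩)
    _ ≤ _ := lintegral_mono_set (Set.Ioo_subset_Ioo_right (min_le_left _ _))
end

section
/- Assume R(u) < 0 for all u > 0, that ∫_0^{u₁} F(s)/(−R(s)) ds < ∞ for some u₁ > 0, and let W be a scale function for R which is locally absolutely continuous on [0,∞) with density W′ as above. Define k : (0,∞) → [0,∞) by k(x) = b·W′(x) + ∫_(0,∞) (W(x) − W(x−ξ)) m(dξ), with W(x−ξ) understood as 0 when x − ξ < 0. Then ∫_0^∞ min(1,x)·(k(x)/x) dx < ∞, and for every u ≥ 0 one has the Lévy–Khintchine decomposition ∫_0^u F(s)/(−R(s)) ds = u·b·W(0) + ∫_0^∞ (1 − e^{−ux})·(k(x)/x) dx. -/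
open MeasureTheory Filter Set
open scoped ENNReal Topology

theorem sFinite_of_lintegral_lt_top {α : Type*} [MeasurableSpace α] {ν : Measure α}
    {f : α → ℝ≥0∞} (hf : Measurable f) (h0 : ∀ᵐ x ∂ν, f x ≠ 0) (h : ∫⁻ x, f x ∂ν < ⊤) :
    SFinite ν := by
  have hfin := isFiniteMeasure_withDensity h.ne
  rw [← withDensity_inv_same hf h0 (ae_lt_top hf h.ne |>.mono fun x hx => hx.ne)]
  infer_instance

theorem sFinite_restrict_of_min_one {m : Measure ℝ}
    (hm : ∫⁻ ξ in Ioi (0:ℝ), ENNReal.ofReal (min ξ 1) ∂m < ⊤) :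
    SFinite (m.restrict (Ioi 0)) := by
  refine sFinite_of_lintegral_lt_top (by fun_prop) ?_ hm
  filter_upwards [ae_restrict_mem measurableSet_Ioi] with ξ hξ
  simpa using hξ

theorem lintegral_exp_Ioi {s : ℝ} (hs : 0 < s) (t : ℝ) :
    ∫⁻ x in Ioi t, ENNReal.ofReal (Real.exp (-(s * x)))
      = ENNReal.ofReal (Real.exp (-(s * t)) / s) := by
  have h := integral_exp_mul_Ioi (neg_lt_zero.mpr hs) t
  have hi := integrableOn_exp_mul_Ioi (neg_lt_zero.mpr hs) t
  simp only [neg_mul] at h hi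
  rw [← ofReal_integral_eq_lintegral_ofReal hi (ae_of_all _ fun _ => (Real.exp_pos _).le), h,
    neg_div_neg_eq]

theorem lintegral_exp_Ioo {u x : ℝ} (hu : 0 ≤ u) (hx : 0 < x) :
    ∫⁻ s in Ioo (0:ℝ) u, ENNReal.ofReal (Real.exp (-(s * x)))
      = ENNReal.ofReal (1 - Real.exp (-(u * x))) / ENNReal.ofReal x := by
  have hc : Continuous fun s : ℝ => Real.exp (-(s * x)) := by fun_prop
  have h : ∫ s in (0:ℝ)..u, Real.exp (-(s * x)) = (1 - Real.exp (-(u * x))) / x := by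
    rw [intervalIntegral.integral_eq_sub_of_hasDerivAt
      (f := fun s => -Real.exp (-(s * x)) / x) (fun s _ => ?_) (hc.intervalIntegrable _ _)]
    · simp; ring
    · have hd : HasDerivAt (fun s => -Real.exp (-(s * x)) / x)
          (-(Real.exp (-(s * x)) * -x) / x) s :=
        (((hasDerivAt_mul_const x).fun_neg.exp).fun_neg).div_const x
      refine hd.congr_deriv ?_
      field_simp
  rw [setLIntegral_congr Ioo_ae_eq_Ioc, ← ofReal_integral_eq_lintegral_ofReal
    ((intervalIntegrable_iff_integrableOn_Ioc_of_le hu).mp (hc.intervalIntegrable _ _))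
    (ae_of_all _ fun _ => (Real.exp_pos _).le),
    ← intervalIntegral.integral_of_le hu, h, ENNReal.ofReal_div_of_pos hx]

theorem one_sub_exp_mul_min_le {u x : ℝ} (hu : 0 ≤ u) (hx : 0 < x) :
    (1 - Real.exp (-u)) * min 1 x ≤ 1 - Real.exp (-(u * x)) := by
  rcases le_total x 1 with h | h
  · rw [min_eq_right h]
    have := convexOn_exp.2 (mem_univ (-u)) (mem_univ 0) hx.le (sub_nonneg.mpr h) (by ring)
    simp only [smul_eq_mul, mul_zero, add_zero, Real.exp_zero, mul_one] at this
    rw [show -(u * x) = x * -u by ring]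
    linarith
  · rw [min_eq_left h, mul_one]
    gcongr
    nlinarith

theorem integrableOn_one_sub_exp {m : Measure ℝ}
    (hm : ∫⁻ ξ in Ioi (0:ℝ), ENNReal.ofReal (min ξ 1) ∂m < ⊤) {s : ℝ} (hs : 0 ≤ s) :
    IntegrableOn (fun ξ => 1 - Real.exp (-(s * ξ))) (Ioi 0) m := by
  have hmin : IntegrableOn (fun ξ : ℝ => min ξ 1) (Ioi 0) m := by
    refine ⟨by fun_prop, ?_⟩
    rw [hasFiniteIntegral_iff_ofReal]
    · exact hm
    · filter_upwards [ae_restrict_mem measurableSet_Ioi] with ξ hξ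
      exact le_min (le_of_lt hξ) zero_le_one
  refine (hmin.const_mul (max s 1)).mono (by fun_prop) ?_
  filter_upwards [ae_restrict_mem measurableSet_Ioi] with ξ hξ
  have hξ' : 0 < ξ := hξ
  have h0 : Real.exp (-(s * ξ)) ≤ 1 := Real.exp_le_one_iff.mpr (by nlinarith)
  have hmx : 0 ≤ max s 1 * min ξ 1 := by positivity
  rw [Real.norm_of_nonneg (by linarith), Real.norm_of_nonneg hmx]
  rcases le_total ξ 1 with h | h
  · rw [min_eq_left h]
    have h1 := Real.add_one_le_exp (-(s * ξ))
    have h2 : s * ξ ≤ max s 1 * ξ := by gcongr; exact le_max_left _ _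
    linarith
  · rw [min_eq_right h]
    have := le_max_right s 1
    have := Real.exp_pos (-(s * ξ))
    linarith

theorem ofReal_subordinator_exponent {b : ℝ} (hb : 0 ≤ b) {m : Measure ℝ}
    (hm : ∫⁻ ξ in Ioi (0:ℝ), ENNReal.ofReal (min ξ 1) ∂m < ⊤) {s : ℝ} (hs : 0 ≤ s) :
    ENNReal.ofReal (b * s - ∫ ξ in Ioi (0:ℝ), (Real.exp (-(s * ξ)) - 1) ∂m)
      = ENNReal.ofReal (b * s)
        + ∫⁻ ξ in Ioi (0:ℝ), ENNReal.ofReal (1 - Real.exp (-(s * ξ))) ∂m := by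
  have hnn : 0 ≤ᵐ[m.restrict (Ioi 0)] fun ξ => 1 - Real.exp (-(s * ξ)) := by
    filter_upwards [ae_restrict_mem measurableSet_Ioi] with ξ hξ
    have : Real.exp (-(s * ξ)) ≤ 1 :=
      Real.exp_le_one_iff.mpr (neg_nonpos.mpr (mul_nonneg hs (le_of_lt hξ)))
    simpa using this
  rw [← ofReal_integral_eq_lintegral_ofReal (integrableOn_one_sub_exp hm hs) hnn,
    ← ENNReal.ofReal_add (mul_nonneg hb hs) (integral_nonneg_of_ae hnn), sub_eq_add_neg,
    ← integral_neg]
  simp only [neg_sub]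

/-- The Laplace transform of `W - W (· - ξ)` for `W` supported on `[0,∞)`. -/
theorem laplace_sub_shift {W : ℝ → ℝ} (hW : Monotone W) (hWnonneg : ∀ x, 0 ≤ W x)
    (hWzero : ∀ x < (0:ℝ), W x = 0) {s : ℝ} {ξ : ℝ} (hs : 0 ≤ s) (hξ : 0 ≤ ξ)
    (hfin : ∫⁻ x in Ioi (0:ℝ), ENNReal.ofReal (Real.exp (-(s * x)) * W x) ≠ ⊤) :
    ∫⁻ x in Ioi (0:ℝ),
        ENNReal.ofReal (Real.exp (-(s * x))) * ENNReal.ofReal (W x - W (x - ξ))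
      = ENNReal.ofReal (1 - Real.exp (-(s * ξ)))
        * ∫⁻ x in Ioi (0:ℝ), ENNReal.ofReal (Real.exp (-(s * x)) * W x) := by
  have hWm := hW.measurable
  have whole : ∀ f : ℝ → ℝ≥0∞, (∀ x < 0, f x = 0) → ∫⁻ x in Ioi (0:ℝ), f x = ∫⁻ x, f x := by
    intro f hf
    rw [setLIntegral_congr Ioi_ae_eq_Ici]
    refine setLIntegral_eq_of_support_subset fun x hx => ?_
    by_contra h
    exact hx (hf x (not_le.mp h))
  have hshift : ∫⁻ x in Ioi (0:ℝ), ENNReal.ofReal (Real.exp (-(s * x)) * W (x - ξ))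
      = ENNReal.ofReal (Real.exp (-(s * ξ)))
        * ∫⁻ x in Ioi (0:ℝ), ENNReal.ofReal (Real.exp (-(s * x)) * W x) := by
    rw [whole _ fun x hx => by simp [hWzero (x - ξ) (by linarith)],
      whole _ fun x hx => by simp [hWzero x hx],
      ← lintegral_sub_right_eq_self (fun x => ENNReal.ofReal (Real.exp (-(s * x)) * W x)) ξ,
      ← lintegral_const_mul _ (by fun_prop)]
    refine lintegral_congr fun x => ?_
    rw [← ENNReal.ofReal_mul (Real.exp_pos _).le, ← mul_assoc, ← Real.exp_add]
    ring_nf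
  have hsplit : ∫⁻ x in Ioi (0:ℝ), ENNReal.ofReal (Real.exp (-(s * x)) * W x)
      = (∫⁻ x in Ioi (0:ℝ),
          ENNReal.ofReal (Real.exp (-(s * x))) * ENNReal.ofReal (W x - W (x - ξ)))
        + ∫⁻ x in Ioi (0:ℝ), ENNReal.ofReal (Real.exp (-(s * x)) * W (x - ξ)) := by
    rw [← lintegral_add_right _ (by fun_prop)]
    refine lintegral_congr fun x => ?_
    have h1 : 0 ≤ W x - W (x - ξ) := sub_nonneg.mpr (hW (by linarith))
    rw [← ENNReal.ofReal_mul (Real.exp_pos _).le, ← ENNReal.ofReal_add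
      (mul_nonneg (Real.exp_pos _).le h1) (mul_nonneg (Real.exp_pos _).le (hWnonneg _))]
    ring_nf
  have hexp : Real.exp (-(s * ξ)) ≤ 1 := Real.exp_le_one_iff.mpr (by nlinarith)
  set L := ∫⁻ x in Ioi (0:ℝ), ENNReal.ofReal (Real.exp (-(s * x)) * W x)
  rw [hshift] at hsplit
  refine (ENNReal.add_left_inj (ENNReal.mul_ne_top
    (ENNReal.ofReal_ne_top (r := Real.exp (-(s * ξ)))) hfin)).mp ?_
  rw [← hsplit, ← add_mul, ← ENNReal.ofReal_add (by linarith) (Real.exp_pos _).le]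
  simp

theorem aemeasurable_Ioi_of_integrableOn_Ioc {w : ℝ → ℝ}
    (h : ∀ y > (0:ℝ), IntegrableOn w (Ioc 0 y)) : AEMeasurable w (volume.restrict (Ioi 0)) := by
  have hU : (⋃ n : ℕ, Ioc (0:ℝ) (n + 1)) = Ioi 0 := by
    ext x
    simp only [mem_iUnion, mem_Ioc, mem_Ioi]
    refine ⟨fun ⟨_, hn⟩ => hn.1, fun hx => ?_⟩
    obtain ⟨n, hn⟩ := exists_nat_ge x
    exact ⟨n, hx, by linarith⟩
  rw [← hU, aemeasurable_iUnion_iff]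
  exact fun n => (h _ (by positivity)).aemeasurable

/-- Integration by parts for the Laplace transform of an absolutely continuous function. -/
theorem mul_laplace_eq_add_laplace_deriv {W w : ℝ → ℝ} (hW0 : 0 ≤ W 0)
    (hw : ∀ x > (0:ℝ), 0 ≤ w x) (hint : ∀ y > (0:ℝ), IntegrableOn w (Ioc 0 y))
    (hftc : ∀ y ≥ (0:ℝ), W y = W 0 + ∫ t in Ioc (0:ℝ) y, w t) {s : ℝ} (hs : 0 < s) :
    ENNReal.ofReal s * ∫⁻ x in Ioi (0:ℝ), ENNReal.ofReal (Real.exp (-(s * x)) * W x)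
      = ENNReal.ofReal (W 0)
        + ∫⁻ x in Ioi (0:ℝ), ENNReal.ofReal (Real.exp (-(s * x))) * ENNReal.ofReal (w x) := by
  have hwm := aemeasurable_Ioi_of_integrableOn_Ioc hint
  let e : ℝ → ℝ≥0∞ := fun x => ENNReal.ofReal (Real.exp (-(s * x)))
  have he : Measurable e := by fun_prop
  let f : ℝ → ℝ → ℝ≥0∞ := fun x t => e x * (Iio x).indicator (fun t => ENNReal.ofReal (w t)) t
  have hrepr : ∀ x ∈ Ioi (0:ℝ), ENNReal.ofReal (Real.exp (-(s * x)) * W x)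
      = e x * ENNReal.ofReal (W 0) + ∫⁻ t in Ioi (0:ℝ), f x t := by
    intro x hx
    have hx0 : 0 ≤ x := le_of_lt hx
    have hnn : 0 ≤ᵐ[volume.restrict (Ioc 0 x)] w := by
      filter_upwards [ae_restrict_mem measurableSet_Ioc] with t ht using hw t ht.1
    rw [ENNReal.ofReal_mul (Real.exp_pos _).le, hftc x hx0,
      ENNReal.ofReal_add hW0 (integral_nonneg_of_ae hnn),
      ofReal_integral_eq_lintegral_ofReal (hint x hx) hnn, mul_add,
      lintegral_const_mul' _ _ ENNReal.ofReal_ne_top, lintegral_indicator measurableSet_Iio,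
      Measure.restrict_restrict measurableSet_Iio, inter_comm, Ioi_inter_Iio,
      setLIntegral_congr (Ioo_ae_eq_Ioc (a := (0:ℝ)))]
  have hswap : ∫⁻ x in Ioi (0:ℝ), ∫⁻ t in Ioi (0:ℝ), f x t
      = ∫⁻ t in Ioi (0:ℝ), ∫⁻ x in Ioi (0:ℝ), f x t := by
    refine lintegral_lintegral_swap ?_
    have h1 : AEMeasurable (fun p : ℝ × ℝ => ENNReal.ofReal (w p.2))
        ((volume.restrict (Ioi (0:ℝ))).prod (volume.restrict (Ioi (0:ℝ)))) :=
      hwm.ennreal_ofReal.comp_snd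
    have h2 := h1.indicator (measurableSet_lt (measurable_snd (α := ℝ)) measurable_fst)
    exact (he.comp measurable_fst).aemeasurable.mul h2
  have hinner : ∀ t ∈ Ioi (0:ℝ), ∫⁻ x in Ioi (0:ℝ), f x t
      = ENNReal.ofReal (Real.exp (-(s * t)) / s) * ENNReal.ofReal (w t) := by
    intro t ht
    have : ∀ x, f x t = (Ioi t).indicator (fun x => e x * ENNReal.ofReal (w t)) x := by
      intro x
      by_cases h : t < x <;> simp [f, h]
    simp_rw [this]
    rw [lintegral_indicator measurableSet_Ioi, Measure.restrict_restrict measurableSet_Ioi,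
      Ioi_inter_Ioi, max_eq_left (le_of_lt ht), lintegral_mul_const _ he, lintegral_exp_Ioi hs]
  rw [setLIntegral_congr_fun measurableSet_Ioi hrepr, lintegral_add_left (by fun_prop), hswap,
    setLIntegral_congr_fun measurableSet_Ioi hinner, lintegral_mul_const _ he,
    lintegral_exp_Ioi hs, mul_add, ← mul_assoc, ← ENNReal.ofReal_mul hs.le,
    ← lintegral_const_mul' _ _ ENNReal.ofReal_ne_top]
  congr 1
  · simp [hs.ne']
  · refine lintegral_congr fun t => ?_
    rw [← mul_assoc, ← ENNReal.ofReal_mul hs.le, mul_div_cancel₀ _ hs.ne']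

/-- Assume `R < 0` on `(0,∞)`, that `∫_0^{u₁} F(s)/(−R(s)) ds < ∞`
for some `u₁ > 0`, and let `W` be a locally absolutely continuous scale function for `R`
with density `W′`. With `k(x) = b W′(x) + ∫_(0,∞) (W(x) − W(x−ξ)) m(dξ)` (where
`W(x−ξ) = 0` when `x − ξ < 0`), one has `∫_0^∞ min(1,x) k(x)/x dx < ∞` and, for every
`u ≥ 0`, the Lévy–Khintchine decomposition
`∫_0^u F(s)/(−R(s)) ds = u b W(0) + ∫_0^∞ (1 − e^{−ux}) k(x)/x dx`. -/
theorem stmt9 (b : ℝ) (hb : 0 ≤ b) (m : Measure ℝ)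
    (hm : ∫⁻ ξ in Set.Ioi (0:ℝ), ENNReal.ofReal (min ξ 1) ∂m < ⊤)
    (F : ℝ → ℝ)
    (hF : ∀ u, F u = b * u - ∫ ξ in Set.Ioi (0:ℝ), (Real.exp (-(u * ξ)) - 1) ∂m)
    (α β : ℝ) (hα : 0 ≤ α) (μ : Measure ℝ)
    (hμ : ∫⁻ ξ in Set.Ioi (0:ℝ), ENNReal.ofReal (min (ξ ^ 2) 1) ∂μ < ⊤)
    (R : ℝ → ℝ)
    (hR : ∀ u, R u = -α * u ^ 2 + β * u -
      ∫ ξ in Set.Ioi (0:ℝ),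
        (Real.exp (-(u * ξ)) - 1 + (if ξ ≤ 1 then u * ξ else 0)) ∂μ)
    (hRneg : ∀ u > (0:ℝ), R u < 0)
    (hFR : ∃ u₁ > (0:ℝ),
      ∫⁻ s in Set.Ioo (0:ℝ) u₁, ENNReal.ofReal (F s / (-R s)) < ⊤)
    (W : ℝ → ℝ) (hWnonneg : ∀ x, 0 ≤ W x) (hWzero : ∀ x < (0:ℝ), W x = 0)
    (hWmono : MonotoneOn W (Set.Ici 0)) (hWcont : ContinuousOn W (Set.Ici 0))
    (hWlap : ∀ u > (0:ℝ),
      ∫⁻ x in Set.Ioi (0:ℝ), ENNReal.ofReal (Real.exp (-(u * x)) * W x)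
        = ENNReal.ofReal (-1 / R u))
    (W' : ℝ → ℝ) (hW'nonneg : ∀ x > (0:ℝ), 0 ≤ W' x)
    (hW'int : ∀ y > (0:ℝ), IntegrableOn W' (Set.Ioc 0 y))
    (hWftc : ∀ y ≥ (0:ℝ), W y = W 0 + ∫ t in Set.Ioc (0:ℝ) y, W' t)
    (k : ℝ → ℝ≥0∞)
    (hk : ∀ x, k x = ENNReal.ofReal (b * W' x)
      + ∫⁻ ξ in Set.Ioi (0:ℝ), ENNReal.ofReal (W x - W (x - ξ)) ∂m) :
    (∫⁻ x in Set.Ioi (0:ℝ),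
        ENNReal.ofReal (min 1 x) * (k x / ENNReal.ofReal x) < ⊤) ∧
    ∀ u ≥ (0:ℝ),
      ∫⁻ s in Set.Ioo (0:ℝ) u, ENNReal.ofReal (F s / (-R s))
        = ENNReal.ofReal (u * (b * W 0))
          + ∫⁻ x in Set.Ioi (0:ℝ),
              ENNReal.ofReal (1 - Real.exp (-(u * x))) * (k x / ENNReal.ofReal x) := by
  have hsf := sFinite_restrict_of_min_one hm
  have hWm : Monotone W := by
    intro x y hxy
    rcases lt_or_ge x 0 with hx | hx
    · simpa [hWzero x hx] using hWnonneg y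
    · exact hWmono hx (hx.trans hxy) hxy
  have hWmeas := hWm.measurable
  have hW'm := aemeasurable_Ioi_of_integrableOn_Ioc hW'int
  set ν := m.restrict (Ioi (0:ℝ)) with hν
  let e : ℝ → ℝ → ℝ≥0∞ := fun s x => ENNReal.ofReal (Real.exp (-(s * x)))
  have he : Measurable (Function.uncurry e) := by fun_prop
  have hes : ∀ s, Measurable (e s) := fun s => by fun_prop
  let J : ℝ → ℝ≥0∞ := fun x => ∫⁻ ξ, ENNReal.ofReal (W x - W (x - ξ)) ∂ν
  have hJ : Measurable J :=
    Measurable.lintegral_prod_right (f := fun x ξ => ENNReal.ofReal (W x - W (x - ξ)))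
      (by unfold Function.uncurry; fun_prop)
  have hkm : AEMeasurable k (volume.restrict (Ioi 0)) := by
    rw [funext hk]
    exact (hW'm.const_mul b).ennreal_ofReal.add hJ.aemeasurable
  have hlap : ∀ s > (0:ℝ), ENNReal.ofReal (F s / (-R s))
      = ENNReal.ofReal (b * W 0) + ∫⁻ x in Ioi (0:ℝ), e s x * k x := by
    intro s hs
    have hL := hWlap s hs
    set L := ∫⁻ x in Ioi (0:ℝ), ENNReal.ofReal (Real.exp (-(s * x)) * W x)
    have hLfin : L ≠ ⊤ := hL ▸ ENNReal.ofReal_ne_top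
    have hdrift : ENNReal.ofReal (b * s) * L = ENNReal.ofReal (b * W 0)
        + ∫⁻ x in Ioi (0:ℝ), e s x * ENNReal.ofReal (b * W' x) := by
      rw [ENNReal.ofReal_mul hb, mul_assoc,
        mul_laplace_eq_add_laplace_deriv (hWnonneg 0) hW'nonneg hW'int hWftc hs, mul_add,
        ← ENNReal.ofReal_mul hb, ← lintegral_const_mul' _ _ ENNReal.ofReal_ne_top]
      congr 1
      refine lintegral_congr fun x => ?_
      rw [ENNReal.ofReal_mul hb, mul_left_comm]
    have hjump : (∫⁻ ξ, ENNReal.ofReal (1 - Real.exp (-(s * ξ))) ∂ν) * L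
        = ∫⁻ x in Ioi (0:ℝ), e s x * J x := by
      rw [← lintegral_mul_const _ (by fun_prop)]
      have h1 : ∀ ξ ∈ Ioi (0:ℝ), ENNReal.ofReal (1 - Real.exp (-(s * ξ))) * L
          = ∫⁻ x in Ioi (0:ℝ), e s x * ENNReal.ofReal (W x - W (x - ξ)) :=
        fun ξ hξ => (laplace_sub_shift hWm hWnonneg hWzero hs.le (le_of_lt hξ) hLfin).symm
      rw [hν, setLIntegral_congr_fun measurableSet_Ioi h1, ← hν,
        lintegral_lintegral_swap (by unfold Function.uncurry; fun_prop)]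
      exact lintegral_congr fun x => lintegral_const_mul' _ _ ENNReal.ofReal_ne_top
    have heJ : Measurable fun x => e s x * J x := (hes s).mul hJ
    have hR' : 0 ≤ -1 / R s := div_nonneg_of_nonpos (by norm_num) (hRneg s hs).le
    rw [show F s / (-R s) = F s * (-1 / R s) by ring, ENNReal.ofReal_mul' hR', ← hL, hF,
      ofReal_subordinator_exponent hb hm hs.le, add_mul, hdrift, ← hν, hjump, add_assoc,
      ← lintegral_add_right _ heJ]
    congr 1
    refine lintegral_congr fun x => ?_
    rw [hk, mul_add]
  have hdecomp : ∀ u ≥ (0:ℝ),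
      ∫⁻ s in Ioo (0:ℝ) u, ENNReal.ofReal (F s / (-R s))
        = ENNReal.ofReal (u * (b * W 0)) + ∫⁻ x in Ioi (0:ℝ),
            ENNReal.ofReal (1 - Real.exp (-(u * x))) * (k x / ENNReal.ofReal x) := by
    intro u hu
    rw [setLIntegral_congr_fun measurableSet_Ioo fun s hs => hlap s hs.1,
      lintegral_add_left measurable_const, lintegral_const, Measure.restrict_apply_univ,
      Real.volume_Ioo, sub_zero, mul_comm, ← ENNReal.ofReal_mul hu,
      lintegral_lintegral_swap (he.aemeasurable.mul hkm.comp_snd)]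
    congr 1
    refine setLIntegral_congr_fun measurableSet_Ioi fun x hx => ?_
    rw [lintegral_mul_const _ (by fun_prop), lintegral_exp_Ioo hu hx]
    simp only [div_eq_mul_inv]
    ring
  refine ⟨?_, hdecomp⟩
  obtain ⟨u, hu, hfin⟩ := hFR
  rw [hdecomp u hu.le] at hfin
  have hc : 0 < 1 - Real.exp (-u) := by simpa using hu
  have hle : ENNReal.ofReal (1 - Real.exp (-u)) * ∫⁻ x in Ioi (0:ℝ),
        ENNReal.ofReal (min 1 x) * (k x / ENNReal.ofReal x)
      ≤ ∫⁻ x in Ioi (0:ℝ),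
        ENNReal.ofReal (1 - Real.exp (-(u * x))) * (k x / ENNReal.ofReal x) := by
    rw [← lintegral_const_mul' _ _ ENNReal.ofReal_ne_top]
    refine setLIntegral_mono' measurableSet_Ioi fun x hx => ?_
    rw [← mul_assoc, ← ENNReal.ofReal_mul hc.le]
    gcongr
    exact one_sub_exp_mul_min_le hu.le hx
  refine lt_top_iff_ne_top.mpr fun h => ?_
  rw [h, ENNReal.mul_top (by simpa using hu)] at hle
  exact (ENNReal.add_lt_top.mp hfin).2.not_ge hle
end

section
/- Suppose there exists δ > 0 such that k(x) > 0 for all x ∈ (0,δ). Then the topological support of L is exactly the half-line [γ, ∞). -/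
open MeasureTheory Filter Set
open scoped ENNReal Topology

/-- Two measures on `ℝ` whose exponential moments are finite and agree on an open interval around `0`
are equal. -/
theorem MeasureTheory.Measure.ext_of_lintegral_exp_eq {μ ν : Measure ℝ} {s : Set ℝ}
    (hs : IsOpen s) (hconv : Convex ℝ s) (h0 : (0 : ℝ) ∈ s)
    (hfin : ∀ t ∈ s, ∫⁻ x, ENNReal.ofReal (Real.exp (t * x)) ∂μ ≠ ∞)
    (heq : ∀ t ∈ s, ∫⁻ x, ENNReal.ofReal (Real.exp (t * x)) ∂μ
      = ∫⁻ x, ENNReal.ofReal (Real.exp (t * x)) ∂ν) : μ = ν := by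
  have key (ρ : Measure ℝ) (h : ∀ t ∈ s, ∫⁻ x, ENNReal.ofReal (Real.exp (t * x)) ∂ρ ≠ ∞) :
      IsFiniteMeasure ρ ∧ s ⊆ interior (ProbabilityTheory.integrableExpSet id ρ) := by
    refine ⟨⟨?_⟩, ?_⟩
    · simpa [lt_top_iff_ne_top] using h 0 h0
    · refine interior_maximal (fun t ht ↦ ?_) hs
      refine (lintegral_ofReal_ne_top_iff_integrable ?_ ?_).1 (h t ht)
      · fun_prop
      · exact .of_forall fun x ↦ (Real.exp_pos _).le
  obtain ⟨hμf, hμ⟩ := key μ hfin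
  obtain ⟨hνf, hν⟩ := key ν fun t ht ↦ heq t ht ▸ hfin t ht
  have hreal (t : ℝ) (ht : t ∈ s) :
      ProbabilityTheory.complexMGF id μ t = ProbabilityTheory.complexMGF id ν t := by
    rw [ProbabilityTheory.complexMGF_ofReal, ProbabilityTheory.complexMGF_ofReal]
    congr 1
    simp only [ProbabilityTheory.mgf, id]
    rw [integral_eq_lintegral_of_nonneg_ae (.of_forall fun x ↦ (Real.exp_pos _).le) (by fun_prop),
      integral_eq_lintegral_of_nonneg_ae (.of_forall fun x ↦ (Real.exp_pos _).le) (by fun_prop),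
      heq t ht]
  have hEq : EqOn (ProbabilityTheory.complexMGF id μ) (ProbabilityTheory.complexMGF id ν)
      {z : ℂ | z.re ∈ s} := by
    refine AnalyticOnNhd.eqOn_of_preconnected_of_frequently_eq
      (ProbabilityTheory.analyticOnNhd_complexMGF.mono fun z hz ↦ hμ hz)
      (ProbabilityTheory.analyticOnNhd_complexMGF.mono fun z hz ↦ hν hz)
      (hconv.linear_preimage Complex.reLm).isPreconnected
      (z₀ := ((0 : ℝ) : ℂ)) (by simpa using h0) ?_
    have h_real : ∃ᶠ x : ℝ in 𝓝[≠] 0, ProbabilityTheory.complexMGF id μ x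
        = ProbabilityTheory.complexMGF id ν x :=
      ((eventually_nhdsWithin_of_eventually_nhds (hs.eventually_mem h0)).mono hreal).frequently
    refine Tendsto.frequently ?_ h_real
    refine tendsto_nhdsWithin_iff.2 ⟨?_, ?_⟩
    · exact (Complex.continuous_ofReal.tendsto 0).mono_left nhdsWithin_le_nhds
    · filter_upwards [self_mem_nhdsWithin] with x hx
      simpa using hx
  refine Measure.ext_of_charFun (funext fun t ↦ ?_)
  rw [← ProbabilityTheory.complexMGF_id_mul_I, ← ProbabilityTheory.complexMGF_id_mul_I]
  exact hEq (by simpa using h0)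

section LevyDensity

variable {k : ℝ → ℝ}

lemma integrable_min_mul_levyDensity (hkmeas : Measurable k) (hknonneg : ∀ x > (0 : ℝ), 0 ≤ k x)
    (hkint : ∫⁻ x in Ioi (0 : ℝ), ENNReal.ofReal (min 1 x * (k x / x)) < ⊤) :
    Integrable (fun x ↦ min 1 x * (k x / x)) (volume.restrict (Ioi 0)) := by
  refine (lintegral_ofReal_ne_top_iff_integrable ?_ ?_).1 hkint.ne
  · exact (by fun_prop : Measurable _).aestronglyMeasurable
  · filter_upwards [ae_restrict_mem measurableSet_Ioi] with x hx
    have hx : (0 : ℝ) < x := hx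
    exact mul_nonneg (by positivity) (div_nonneg (hknonneg x hx) hx.le)

lemma Real.mul_exp_neg_mul_le {u x : ℝ} (hu : 0 < u) (hx : 0 < x) :
    x * Real.exp (-(u * x)) ≤ max 1 (1 / u) * min 1 x := by
  have h1 : x * Real.exp (-(u * x)) ≤ x :=
    mul_le_of_le_one_right hx.le (Real.exp_le_one_iff.2 (by nlinarith [mul_pos hu hx]))
  have h2 : x * Real.exp (-(u * x)) ≤ 1 / u := by
    rw [Real.exp_neg, ← div_eq_mul_inv, div_le_div_iff₀ (Real.exp_pos _) hu]
    nlinarith [Real.add_one_le_exp (u * x)]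
  rcases min_cases 1 x with ⟨h, -⟩ | ⟨h, -⟩ <;> rw [h]
  · simpa using h2.trans (le_max_right _ _)
  · exact h1.trans (le_mul_of_one_le_left hx.le (le_max_left _ _))

lemma Real.abs_exp_neg_mul_sub_one_le {u x : ℝ} (hu : 0 ≤ u) (hx : 0 < x) :
    |Real.exp (-(u * x)) - 1| ≤ max 1 u * min 1 x := by
  have hux := mul_nonneg hu hx.le
  have h0 : Real.exp (-(u * x)) ≤ 1 := Real.exp_le_one_iff.2 (by linarith)
  rw [abs_of_nonpos (by linarith)]
  rcases min_cases 1 x with ⟨h, -⟩ | ⟨h, -⟩ <;> rw [h]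
  · linarith [le_max_left 1 u, Real.exp_pos (-(u * x))]
  · nlinarith [le_max_right 1 u, Real.add_one_le_exp (-(u * x))]

lemma hasDerivAt_levyExponent (hkmeas : Measurable k) (hknonneg : ∀ x > (0 : ℝ), 0 ≤ k x)
    (hk : Integrable (fun x ↦ min 1 x * (k x / x)) (volume.restrict (Ioi 0)))
    {u : ℝ} (hu : 0 < u) :
    Integrable (fun x ↦ -(Real.exp (-(u * x)) * k x)) (volume.restrict (Ioi 0)) ∧
      HasDerivAt (fun v ↦ ∫ x in Ioi (0 : ℝ), (Real.exp (-(v * x)) - 1) * (k x / x))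
        (∫ x in Ioi (0 : ℝ), -(Real.exp (-(u * x)) * k x)) u := by
  refine hasDerivAt_integral_of_dominated_loc_of_deriv_le
    (bound := fun x ↦ max 1 (2 / u) * (min 1 x * (k x / x))) (s := Ioi (u / 2))
    (F' := fun v x ↦ -(Real.exp (-(v * x)) * k x))
    (Ioi_mem_nhds (by linarith)) (.of_forall fun v ↦ ?_) ?_ ?_ ?_ (hk.const_mul _) ?_
  · exact (by fun_prop : Measurable _).aestronglyMeasurable
  · refine (hk.const_mul (max 1 u)).mono' (by fun_prop : Measurable _).aestronglyMeasurable ?_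
    filter_upwards [ae_restrict_mem measurableSet_Ioi] with x hx
    have hx : (0 : ℝ) < x := hx
    have hg : 0 ≤ k x / x := div_nonneg (hknonneg x hx) hx.le
    rw [norm_mul, Real.norm_eq_abs, Real.norm_of_nonneg hg, ← mul_assoc]
    exact mul_le_mul_of_nonneg_right (Real.abs_exp_neg_mul_sub_one_le hu.le hx) hg
  · exact (by fun_prop : Measurable _).aestronglyMeasurable
  · filter_upwards [ae_restrict_mem measurableSet_Ioi] with x hx v hv
    have hx : (0 : ℝ) < x := hx
    have hv : u / 2 < v := hv
    have hg : 0 ≤ k x / x := div_nonneg (hknonneg x hx) hx.le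
    have hle := Real.mul_exp_neg_mul_le (by linarith : 0 < v) hx
    have hC : max 1 (1 / v) ≤ max 1 (2 / u) := by
      refine max_le_max le_rfl ?_
      rw [div_le_div_iff₀ (by linarith) hu]
      linarith
    have hm : 0 ≤ min 1 x := by positivity
    rw [norm_neg, Real.norm_of_nonneg (mul_nonneg (Real.exp_pos _).le (hknonneg x hx)), ← mul_assoc]
    calc Real.exp (-(v * x)) * k x = x * Real.exp (-(v * x)) * (k x / x) := by field_simp
      _ ≤ max 1 (2 / u) * min 1 x * (k x / x) :=
        mul_le_mul_of_nonneg_right (hle.trans (mul_le_mul_of_nonneg_right hC hm)) hg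
  · filter_upwards [ae_restrict_mem measurableSet_Ioi] with x hx v hv
    have hx : (0 : ℝ) < x := hx
    have h1 : HasDerivAt (fun v : ℝ ↦ -(v * x)) (-x) v := by
      simpa using ((hasDerivAt_id v).mul_const x).fun_neg
    refine ((h1.exp.sub_const 1).mul_const (k x / x)).congr_deriv ?_
    field_simp

lemma tendsto_levyExponent_div_atTop (hkmeas : Measurable k) (hknonneg : ∀ x > (0 : ℝ), 0 ≤ k x)
    (hk : Integrable (fun x ↦ min 1 x * (k x / x)) (volume.restrict (Ioi 0))) :
    Tendsto (fun u ↦ (∫ x in Ioi (0 : ℝ), (Real.exp (-(u * x)) - 1) * (k x / x)) / u)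
      atTop (𝓝 0) := by
  simp_rw [← integral_div]
  suffices Tendsto (fun u ↦ ∫ x in Ioi (0 : ℝ), (Real.exp (-(u * x)) - 1) * (k x / x) / u)
      atTop (𝓝 (∫ x in Ioi (0 : ℝ), (0 : ℝ))) by simpa using this
  refine tendsto_integral_filter_of_dominated_convergence
    (fun x ↦ min 1 x * (k x / x)) (.of_forall fun u ↦ ?_) ?_ hk ?_
  · exact (by fun_prop : Measurable _).aestronglyMeasurable
  · filter_upwards [eventually_ge_atTop 1] with u hu
    filter_upwards [ae_restrict_mem measurableSet_Ioi] with x hx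
    have hx : (0 : ℝ) < x := hx
    have hg : 0 ≤ k x / x := div_nonneg (hknonneg x hx) hx.le
    have h := Real.abs_exp_neg_mul_sub_one_le (by linarith : 0 ≤ u) hx
    rw [max_eq_right hu] at h
    rw [norm_div, norm_mul, Real.norm_eq_abs, Real.norm_of_nonneg hg,
      Real.norm_of_nonneg (by linarith : 0 ≤ u), div_le_iff₀ (by linarith)]
    nlinarith
  · filter_upwards [ae_restrict_mem measurableSet_Ioi] with x hx
    have hx : (0 : ℝ) < x := hx
    have h1 : Tendsto (fun u : ℝ ↦ Real.exp (-(u * x))) atTop (𝓝 0) :=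
      Real.tendsto_exp_neg_atTop_nhds_zero.comp (tendsto_id.atTop_mul_const hx)
    have h2 := ((h1.sub_const 1).mul_const (k x / x)).mul tendsto_inv_atTop_zero
    simpa [div_eq_mul_inv] using h2

end LevyDensity

lemma MeasureTheory.Measure.conv_ball_pos {μ ν : Measure ℝ} [SFinite μ] [SFinite ν] {s t ε : ℝ}
    (hμ : 0 < μ (Metric.ball s (ε / 2))) (hν : 0 < ν (Metric.ball t (ε / 2))) :
    0 < (μ.conv ν) (Metric.ball (s + t) ε) := by
  rw [Measure.conv, Measure.map_apply measurable_add Metric.isOpen_ball.measurableSet]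
  refine (ENNReal.mul_pos hμ.ne' hν.ne').trans_le ?_
  rw [← Measure.prod_prod]
  refine measure_mono fun p hp ↦ ?_
  have h1 := abs_lt.1 (Real.dist_eq _ _ ▸ Metric.mem_ball.1 hp.1)
  have h2 := abs_lt.1 (Real.dist_eq _ _ ▸ Metric.mem_ball.1 hp.2)
  rw [mem_preimage, Metric.mem_ball, Real.dist_eq, abs_lt]
  constructor <;> linarith [h1.1, h1.2, h2.1, h2.2]

lemma lintegral_exp_mul_withDensity (m : Measure ℝ) {f : ℝ → ℝ} (hf : Measurable f) (t : ℝ) :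
    ∫⁻ x, ENNReal.ofReal (Real.exp (t * x))
        ∂(m.withDensity fun x ↦ ENNReal.ofReal (Real.exp (-x) * f x))
      = ∫⁻ x, ENNReal.ofReal (Real.exp (-((1 - t) * x)) * f x) ∂m := by
  rw [lintegral_withDensity_eq_lintegral_mul _ (by fun_prop) (by fun_prop)]
  refine lintegral_congr fun x ↦ ?_
  rw [Pi.mul_apply, ← ENNReal.ofReal_mul' (Real.exp_pos _).le, mul_right_comm, ← Real.exp_add]
  congr 3
  ring

section LaplaceTransform

variable {L : Measure ℝ} [IsProbabilityMeasure L]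

lemma integrable_exp_neg_mul (hL : L (Iio 0) = 0) {u : ℝ} (hu : 0 ≤ u) :
    Integrable (fun x ↦ Real.exp (-(u * x))) L := by
  refine (integrable_const (1 : ℝ)).mono' (by fun_prop) ?_
  have h : ∀ᵐ x ∂L, x ∉ Iio (0 : ℝ) := measure_eq_zero_iff_ae_notMem.1 hL
  filter_upwards [h] with x hx
  have hx : 0 ≤ x := not_lt.1 hx
  rw [Real.norm_of_nonneg (Real.exp_pos _).le, Real.exp_le_one_iff]
  linarith [mul_nonneg hu hx]

lemma ae_le_of_laplace_le (hL : L (Iio 0) = 0) {γ : ℝ}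
    (h : ∀ u ≥ (0 : ℝ), ∫ x, Real.exp (-(u * x)) ∂L ≤ Real.exp (-(γ * u))) :
    ∀ᵐ x ∂L, γ ≤ x := by
  have key (c : ℝ) (hc : c < γ) : L (Iic c) = 0 := by
    have hle (u : ℝ) (hu : 0 ≤ u) : L.real (Iic c) ≤ Real.exp (-(u * (γ - c))) := by
      have hint : Integrable (fun x ↦ Real.exp (-u * id x)) L := by
        simpa using integrable_exp_neg_mul hL hu
      have h1 := ProbabilityTheory.measure_le_le_exp_mul_mgf c (neg_nonpos.2 hu) hint
      have h2 := h u hu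
      simp only [ProbabilityTheory.mgf, id, neg_neg, neg_mul] at h1
      calc L.real (Iic c) ≤ Real.exp (u * c) * ∫ x, Real.exp (-(u * x)) ∂L := h1
        _ ≤ Real.exp (u * c) * Real.exp (-(γ * u)) := by gcongr
        _ = Real.exp (-(u * (γ - c))) := by rw [← Real.exp_add]; ring_nf
    have hlim : Tendsto (fun u : ℝ ↦ Real.exp (-(u * (γ - c)))) atTop (𝓝 0) :=
      Real.tendsto_exp_neg_atTop_nhds_zero.comp (tendsto_id.atTop_mul_const (sub_pos.2 hc))
    have h0 : L.real (Iic c) ≤ 0 :=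
      ge_of_tendsto hlim ((eventually_ge_atTop 0).mono hle)
    exact (measureReal_eq_zero_iff).1 (le_antisymm h0 measureReal_nonneg)
  have hq : ∀ᵐ x ∂L, ∀ q : ℚ, (q : ℝ) < γ → (q : ℝ) ≤ x := by
    refine ae_all_iff.2 fun q ↦ ?_
    by_cases hqγ : (q : ℝ) < γ
    · filter_upwards [measure_eq_zero_iff_ae_notMem.1 (key q hqγ)] with x hx _
      exact (not_le.1 hx).le
    · exact .of_forall fun x hx ↦ absurd hx hqγ
  filter_upwards [hq] with x hx
  exact le_of_forall_rat_lt_imp_le hx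

lemma hasDerivAt_laplace (hL : L (Iio 0) = 0) {u : ℝ} (hu : 0 < u) :
    Integrable (fun x ↦ x * Real.exp (-(u * x))) L ∧
      HasDerivAt (fun v ↦ ∫ x, Real.exp (-(v * x)) ∂L)
        (-∫ x, x * Real.exp (-(u * x)) ∂L) u := by
  have hmem : -u ∈ interior (ProbabilityTheory.integrableExpSet id L) := by
    refine interior_maximal (s := ProbabilityTheory.integrableExpSet id L) (t := Iio 0)
      (fun t ht ↦ ?_) isOpen_Iio (by simpa using hu)
    have := integrable_exp_neg_mul hL (neg_nonneg.2 (mem_Iio.1 ht).le)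
    simpa [ProbabilityTheory.integrableExpSet] using this
  constructor
  · simpa using
      ProbabilityTheory.integrable_pow_mul_exp_of_mem_interior_integrableExpSet hmem 1
  · have h := (ProbabilityTheory.hasDerivAt_mgf hmem).scomp u (hasDerivAt_neg u)
    simpa [ProbabilityTheory.mgf, Function.comp_def] using h

end LaplaceTransform

section SizeBias

variable {γ : ℝ} {k : ℝ → ℝ} {L : Measure ℝ} [IsProbabilityMeasure L]

lemma integral_sub_mul_exp_eq (hkmeas : Measurable k) (hknonneg : ∀ x > (0 : ℝ), 0 ≤ k x)
    (hk : Integrable (fun x ↦ min 1 x * (k x / x)) (volume.restrict (Ioi 0)))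
    (hL : L (Iio 0) = 0)
    (hLap : ∀ u ≥ (0 : ℝ), ∫ x, Real.exp (-(u * x)) ∂L
      = Real.exp (-(γ * u) + ∫ x in Ioi (0 : ℝ), (Real.exp (-(u * x)) - 1) * (k x / x)))
    {u : ℝ} (hu : 0 < u) :
    ∫ x, Real.exp (-(u * x)) * (x - γ) ∂L
      = (∫ x in Ioi (0 : ℝ), Real.exp (-(u * x)) * k x) * ∫ x, Real.exp (-(u * x)) ∂L := by
  obtain ⟨hint, hder⟩ := hasDerivAt_laplace hL hu
  have hψ := (hasDerivAt_levyExponent hkmeas hknonneg hk hu).2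
  have hlin : HasDerivAt (fun v : ℝ ↦ -(γ * v)) (-γ) u := by
    simpa using ((hasDerivAt_id u).const_mul γ).fun_neg
  have hder' := (hlin.fun_add hψ).exp
  have heq := hder.unique (hder'.congr_of_eventuallyEq
    ((eventually_ge_nhds hu).mono fun v hv ↦ hLap v hv))
  rw [← hLap u hu.le, integral_neg] at heq
  have hsplit : ∫ x, Real.exp (-(u * x)) * (x - γ) ∂L
      = ∫ x, x * Real.exp (-(u * x)) ∂L - γ * ∫ x, Real.exp (-(u * x)) ∂L := by
    rw [← integral_const_mul, ← integral_sub hint ((integrable_exp_neg_mul hL hu.le).const_mul γ)]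
    refine integral_congr_ae (.of_forall fun x ↦ ?_)
    simp only
    ring
  rw [hsplit]
  linarith

lemma withDensity_sub_eq_conv (hkmeas : Measurable k) (hknonneg : ∀ x > (0 : ℝ), 0 ≤ k x)
    (hk : Integrable (fun x ↦ min 1 x * (k x / x)) (volume.restrict (Ioi 0)))
    (hL : L (Iio 0) = 0) (hγL : ∀ᵐ x ∂L, γ ≤ x)
    (hLap : ∀ u ≥ (0 : ℝ), ∫ x, Real.exp (-(u * x)) ∂L
      = Real.exp (-(γ * u) + ∫ x in Ioi (0 : ℝ), (Real.exp (-(u * x)) - 1) * (k x / x))) :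
    (L.withDensity fun x ↦ ENNReal.ofReal (Real.exp (-x) * (x - γ)))
      = ((volume.restrict (Ioi 0)).withDensity
          fun x ↦ ENNReal.ofReal (Real.exp (-x) * k x)).conv
        (L.withDensity fun x ↦ ENNReal.ofReal (Real.exp (-x) * 1)) := by
  have hleft (t : ℝ) (ht : t ∈ Iio (1 : ℝ)) :
      ∫⁻ x, ENNReal.ofReal (Real.exp (t * x))
          ∂(L.withDensity fun x ↦ ENNReal.ofReal (Real.exp (-x) * (x - γ)))
        = ENNReal.ofReal (∫ x, Real.exp (-((1 - t) * x)) * (x - γ) ∂L) := by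
    have hu : 0 < 1 - t := sub_pos.2 ht
    rw [lintegral_exp_mul_withDensity _ (by fun_prop), ofReal_integral_eq_lintegral_ofReal]
    · refine ((hasDerivAt_laplace hL hu).1.sub
        ((integrable_exp_neg_mul hL hu.le).const_mul γ)).congr (.of_forall fun x ↦ ?_)
      simp only [Pi.sub_apply]
      ring
    · filter_upwards [hγL] with x hx
      exact mul_nonneg (Real.exp_pos _).le (sub_nonneg.2 hx)
  refine Measure.ext_of_lintegral_exp_eq isOpen_Iio (convex_Iio 1) (mem_Iio.2 one_pos)
    (fun t ht ↦ ?_)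
    fun t ht ↦ ?_
  · rw [hleft t ht]
    exact ENNReal.ofReal_ne_top
  · have hu : 0 < 1 - t := sub_pos.2 ht
    have hk0 : 0 ≤ᵐ[volume.restrict (Ioi 0)] fun x ↦ Real.exp (-((1 - t) * x)) * k x := by
      filter_upwards [ae_restrict_mem measurableSet_Ioi] with x hx
      exact mul_nonneg (Real.exp_pos _).le (hknonneg x hx)
    have hkint := (hasDerivAt_levyExponent hkmeas hknonneg hk hu).1.neg
    rw [hleft t ht, integral_sub_mul_exp_eq hkmeas hknonneg hk hL hLap hu,
      ENNReal.ofReal_mul (integral_nonneg_of_ae hk0),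
      ofReal_integral_eq_lintegral_ofReal (by simpa [Pi.neg_def] using hkint) hk0,
      ofReal_integral_eq_lintegral_ofReal (integrable_exp_neg_mul hL hu.le)
        (.of_forall fun x ↦ (Real.exp_pos _).le),
      Measure.lintegral_conv (by fun_prop)]
    simp_rw [mul_add, Real.exp_add, ENNReal.ofReal_mul (Real.exp_pos _).le]
    simp_rw [lintegral_const_mul _
      (by fun_prop : Measurable fun x : ℝ ↦ ENNReal.ofReal (Real.exp (t * x)))]
    rw [lintegral_mul_const _ (by fun_prop)]
    simp_rw [← ENNReal.ofReal_mul (Real.exp_pos _).le]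
    rw [lintegral_exp_mul_withDensity _ hkmeas,
      lintegral_exp_mul_withDensity _ (measurable_const (a := (1 : ℝ)))]
    simp_rw [mul_one]

end SizeBias

/-- Let `L` be a probability measure on `[0,∞)` with Laplace transform
`∫ e^{−ux} dL(x) = exp(−γu + ∫_0^∞ (e^{−ux} − 1) k(x)/x dx)` for all `u ≥ 0`, where
`γ ≥ 0` and `k : (0,∞) → [0,∞)` is Borel with `∫_0^∞ min(1,x) k(x)/x dx < ∞`.
If there is `δ > 0` with `k > 0` on `(0,δ)`, then the topological support of `L`
(the set of points all of whose neighborhoods have positive `L`-measure) is exactly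
`[γ,∞)`. -/
theorem stmt12 (γ : ℝ) (hγ : 0 ≤ γ) (k : ℝ → ℝ) (hkmeas : Measurable k)
    (hknonneg : ∀ x > (0:ℝ), 0 ≤ k x)
    (hkint : ∫⁻ x in Set.Ioi (0:ℝ), ENNReal.ofReal (min 1 x * (k x / x)) < ⊤)
    (L : Measure ℝ) [IsProbabilityMeasure L] (hLsupp : L (Set.Iio 0) = 0)
    (hLap : ∀ u ≥ (0:ℝ),
      ∫ x, Real.exp (-(u * x)) ∂L
        = Real.exp (-(γ * u) +
            ∫ x in Set.Ioi (0:ℝ), (Real.exp (-(u * x)) - 1) * (k x / x)))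
    (hδ : ∃ δ > (0:ℝ), ∀ x ∈ Set.Ioo (0:ℝ) δ, 0 < k x) :
    {x : ℝ | ∀ U ∈ 𝓝 x, 0 < L U} = Set.Ici γ := by
  have hk := integrable_min_mul_levyDensity hkmeas hknonneg hkint
  have hγL : ∀ᵐ x ∂L, γ ≤ x := by
    refine ae_le_of_laplace_le hLsupp fun u hu ↦ ?_
    rw [hLap u hu, Real.exp_le_exp]
    refine add_le_of_nonpos_right (setIntegral_nonpos measurableSet_Ioi fun x hx ↦ ?_)
    have hx : (0 : ℝ) < x := hx
    refine mul_nonpos_of_nonpos_of_nonneg ?_ (div_nonneg (hknonneg x hx) hx.le)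
    linarith [Real.exp_le_one_iff.2 (neg_nonpos.2 (mul_nonneg hu hx.le))]
  have hconv := withDensity_sub_eq_conv hkmeas hknonneg hk hLsupp hγL hLap
  obtain ⟨δ, hδ0, hkpos⟩ := hδ
  have hbase : ∀ U ∈ 𝓝 γ, 0 < L U := by
    intro U hU
    by_contra hU0
    have hU0 : L U = 0 := by simpa using hU0
    obtain ⟨η, hη, hball⟩ := Metric.mem_nhds_iff.1 hU
    have hge : ∀ᵐ x ∂L, γ + η ≤ x := by
      filter_upwards [hγL, measure_eq_zero_iff_ae_notMem.1 hU0] with x hx hxU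
      by_contra hlt
      refine hxU (hball ?_)
      rw [Metric.mem_ball, Real.dist_eq, abs_lt]
      constructor <;> linarith
    have hψ (u : ℝ) (hu : 0 < u) :
        (∫ x in Ioi (0 : ℝ), (Real.exp (-(u * x)) - 1) * (k x / x)) / u ≤ -η := by
      have h1 : ∫ x, Real.exp (-(u * x)) ∂L ≤ ∫ _, Real.exp (-(u * (γ + η))) ∂L := by
        refine integral_mono_ae (integrable_exp_neg_mul hLsupp hu.le) (integrable_const _) ?_
        filter_upwards [hge] with x hx
        exact Real.exp_le_exp.2 (neg_le_neg (mul_le_mul_of_nonneg_left hx hu.le))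
      rw [hLap u hu.le, integral_const, probReal_univ, one_smul, Real.exp_le_exp] at h1
      rw [div_le_iff₀ hu]
      linarith
    have := le_of_tendsto (tendsto_levyExponent_div_atTop hkmeas hknonneg hk)
      ((eventually_gt_atTop 0).mono hψ)
    linarith
  have hstep (a t : ℝ) (ha : a ∈ Ioo 0 δ) (ht : ∀ U ∈ 𝓝 t, 0 < L U) :
      ∀ U ∈ 𝓝 (a + t), 0 < L U := by
    intro U hU
    obtain ⟨ε, hε, hball⟩ := Metric.mem_nhds_iff.1 hU
    refine lt_of_lt_of_le ?_ (measure_mono hball)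
    refine pos_iff_ne_zero.2 fun h0 ↦ ?_
    refine ((withDensity_absolutelyContinuous L
      fun x ↦ ENNReal.ofReal (Real.exp (-x) * (x - γ))) h0).not_gt ?_
    rw [hconv]
    refine Measure.conv_ball_pos ?_ ?_
    · have hsub : Ioo (max 0 (a - ε / 2)) (min δ (a + ε / 2)) ⊆ Metric.ball a (ε / 2) := by
        rw [Real.ball_eq_Ioo]
        exact Ioo_subset_Ioo (le_max_right _ _) (min_le_right _ _)
      refine lt_of_lt_of_le (pos_iff_ne_zero.2 fun hz ↦ ?_) (measure_mono hsub)
      rw [withDensity_apply_eq_zero (by fun_prop)] at hz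
      have hpos : Ioo (max 0 (a - ε / 2)) (min δ (a + ε / 2)) ⊆
          {x | ENNReal.ofReal (Real.exp (-x) * k x) ≠ 0} ∩
            Ioo (max 0 (a - ε / 2)) (min δ (a + ε / 2)) := by
        refine fun x hx ↦ ⟨?_, hx⟩
        have hx' : x ∈ Ioo 0 δ :=
          ⟨(le_max_left _ _).trans_lt hx.1, hx.2.trans_le (min_le_left _ _)⟩
        exact (ENNReal.ofReal_pos.2 (mul_pos (Real.exp_pos _) (hkpos x hx'))).ne'
      have hz' := measure_mono_null hpos hz
      rw [Measure.restrict_apply measurableSet_Ioo, inter_eq_left.2, Real.volume_Ioo,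
        ENNReal.ofReal_eq_zero, sub_nonpos] at hz'
      · refine hz'.not_gt (max_lt (lt_min hδ0 ?_) (lt_min ?_ ?_)) <;> linarith [ha.1, ha.2]
      · exact fun x hx ↦ (le_max_left _ _).trans_lt hx.1
    · refine pos_iff_ne_zero.2 fun hz ↦ ?_
      rw [withDensity_apply_eq_zero (by fun_prop)] at hz
      refine (ht _ (Metric.ball_mem_nhds t (half_pos hε))).ne' (measure_mono_null ?_ hz)
      refine fun x hx ↦ ⟨?_, hx⟩
      exact (ENNReal.ofReal_pos.2 (mul_pos (Real.exp_pos _) one_pos)).ne'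
  refine Subset.antisymm (fun x hx ↦ ?_) fun x hx ↦ ?_
  · by_contra hlt
    refine (hx (Iio γ) (Iio_mem_nhds (not_le.1 hlt))).ne' ?_
    exact measure_eq_zero_iff_ae_notMem.2 (hγL.mono fun y hy ↦ not_lt.2 hy)
  · rcases eq_or_lt_of_le (mem_Ici.1 hx) with rfl | hlt
    · exact hbase
    obtain ⟨n, hn⟩ := exists_nat_gt ((x - γ) / δ)
    have hn0 : (0 : ℝ) < n := (div_pos (sub_pos.2 hlt) hδ0).trans hn
    have ha : (x - γ) / n ∈ Ioo 0 δ := by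
      refine ⟨div_pos (sub_pos.2 hlt) hn0, ?_⟩
      rw [div_lt_iff₀ hδ0] at hn
      rw [div_lt_iff₀ hn0]
      linarith
    have hiter (j : ℕ) : ∀ U ∈ 𝓝 (γ + j * ((x - γ) / n)), 0 < L U := by
      induction j with
      | zero => simpa using hbase
      | succ j ih =>
        have h := hstep _ _ ha ih
        rwa [show (x - γ) / n + (γ + j * ((x - γ) / n)) = γ + (j + 1 : ℕ) * ((x - γ) / n) by
          push_cast; ring] at h
    have h := hiter n
    rwa [mul_div_cancel₀ _ hn0.ne', add_sub_cancel] at h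
end

section
/- Exactly one of the following two alternatives holds. If ∫_0^1 k(x)/x dx = ∞, then L is absolutely continuous with respect to Lebesgue measure. If ∫_0^1 k(x)/x dx < ∞, then L has an atom at γ of mass L({γ}) = exp(−∫_0^∞ k(x)/x dx) > 0, and the restriction of L to ℝ \ {γ} is absolutely continuous with respect to Lebesgue measure. -/
open MeasureTheory Filter Set
open scoped ENNReal Topology

/-- `n ↦ e^{-nx}` tends to `0` for `x > 0`. -/
theorem tendsto_exp_neg_nat_mul {x : ℝ} (hx : 0 < x) :
    Tendsto (fun n : ℕ => Real.exp (-((n : ℝ) * x))) atTop (𝓝 0) :=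
  Real.tendsto_exp_neg_atTop_nhds_zero.comp (tendsto_natCast_atTop_atTop.atTop_mul_const hx)

/-- Two finite measures on `ℝ` whose moment-generating functions are finite and agree on a
neighbourhood of `0` are equal. -/
theorem measure_eq_of_mgf_eq_near_zero {μ ν : Measure ℝ} [IsFiniteMeasure μ] [IsFiniteMeasure ν]
    {s : Set ℝ} (hs : s ∈ 𝓝 (0 : ℝ))
    (hμ : s ⊆ ProbabilityTheory.integrableExpSet id μ)
    (hν : s ⊆ ProbabilityTheory.integrableExpSet id ν)
    (h : ∀ t ∈ s, ProbabilityTheory.mgf id μ t = ProbabilityTheory.mgf id ν t) : μ = ν := by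
  have hconv : Convex ℝ (interior (ProbabilityTheory.integrableExpSet id μ) ∩
      interior (ProbabilityTheory.integrableExpSet id ν)) :=
    ProbabilityTheory.convex_integrableExpSet.interior.inter
      ProbabilityTheory.convex_integrableExpSet.interior
  have h0 : (0 : ℝ) ∈ interior (ProbabilityTheory.integrableExpSet id μ) ∩
      interior (ProbabilityTheory.integrableExpSet id ν) :=
    ⟨mem_interior_iff_mem_nhds.2 (mem_of_superset hs hμ),
      mem_interior_iff_mem_nhds.2 (mem_of_superset hs hν)⟩
  have hreal : ∃ᶠ x : ℝ in 𝓝[≠] 0,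
      ProbabilityTheory.complexMGF id μ x = ProbabilityTheory.complexMGF id ν x := by
    refine Eventually.frequently ?_
    filter_upwards [nhdsWithin_le_nhds hs] with x hx
    rw [ProbabilityTheory.complexMGF_ofReal, ProbabilityTheory.complexMGF_ofReal, h x hx]
  have htend : Tendsto (fun x : ℝ => (x : ℂ)) (𝓝[≠] 0) (𝓝[≠] (0 : ℂ)) := by
    refine tendsto_nhdsWithin_iff.2 ⟨?_, ?_⟩
    · exact (Complex.continuous_ofReal.tendsto' 0 0 (by simp)).mono_left nhdsWithin_le_nhds
    · filter_upwards [self_mem_nhdsWithin] with x hx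
      simpa using hx
  have heq : EqOn (ProbabilityTheory.complexMGF id μ) (ProbabilityTheory.complexMGF id ν)
      {z | z.re ∈ interior (ProbabilityTheory.integrableExpSet id μ) ∩
        interior (ProbabilityTheory.integrableExpSet id ν)} :=
    AnalyticOnNhd.eqOn_of_preconnected_of_frequently_eq
      (ProbabilityTheory.analyticOnNhd_complexMGF.mono fun z hz => hz.1)
      (ProbabilityTheory.analyticOnNhd_complexMGF.mono fun z hz => hz.2)
      (hconv.linear_preimage Complex.reLm).isPreconnected
      (z₀ := 0) (by simpa using h0) (htend.frequently hreal)
  refine Measure.ext_of_charFun (funext fun t => ?_)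
  rw [← ProbabilityTheory.complexMGF_id_mul_I, ← ProbabilityTheory.complexMGF_id_mul_I]
  exact heq (by simpa using h0)

/-- A measure on `ℝ` is determined by its Laplace transform on the open half-line, as soon as that
transform is finite there. -/
theorem measure_eq_of_laplace_eq {μ ν : Measure ℝ}
    (hfin : ∀ t < (0 : ℝ), ∫⁻ x, ENNReal.ofReal (Real.exp (t * x)) ∂μ < ⊤)
    (h : ∀ t < (0 : ℝ), ∫⁻ x, ENNReal.ofReal (Real.exp (t * x)) ∂μ
      = ∫⁻ x, ENNReal.ofReal (Real.exp (t * x)) ∂ν) : μ = ν := by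
  have hmeas (t : ℝ) : Measurable fun x : ℝ => ENNReal.ofReal (Real.exp (t * x)) := by fun_prop
  have htilt (ρ : Measure ℝ) (t : ℝ) :
      ∫⁻ x, ENNReal.ofReal (Real.exp (t * x))
          ∂(ρ.withDensity fun x => ENNReal.ofReal (Real.exp (-1 * x)))
        = ∫⁻ x, ENNReal.ofReal (Real.exp ((t - 1) * x)) ∂ρ := by
    rw [lintegral_withDensity_eq_lintegral_mul _ (hmeas _) (hmeas _)]
    refine lintegral_congr fun x => ?_
    rw [Pi.mul_apply, ← ENNReal.ofReal_mul (Real.exp_nonneg _), ← Real.exp_add]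
    congr 2
    ring
  have hfinite (ρ : Measure ℝ) (hρ : ∫⁻ x, ENNReal.ofReal (Real.exp (-1 * x)) ∂ρ < ⊤) :
      IsFiniteMeasure (ρ.withDensity fun x => ENNReal.ofReal (Real.exp (-1 * x))) :=
    isFiniteMeasure_withDensity hρ.ne
  have hset (ρ : Measure ℝ)
      (hρ : ∀ t < (0 : ℝ), ∫⁻ x, ENNReal.ofReal (Real.exp (t * x)) ∂ρ < ⊤) :
      Iio (1 : ℝ) ⊆ ProbabilityTheory.integrableExpSet id
        (ρ.withDensity fun x => ENNReal.ofReal (Real.exp (-1 * x))) := by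
    intro t ht
    refine ⟨by fun_prop, ?_⟩
    rw [hasFiniteIntegral_iff_ofReal (ae_of_all _ fun x => Real.exp_nonneg _)]
    simp only [id]
    rw [htilt]
    exact hρ _ (sub_neg.2 ht)
  have hfin' : ∀ t < (0 : ℝ), ∫⁻ x, ENNReal.ofReal (Real.exp (t * x)) ∂ν < ⊤ :=
    fun t ht => h t ht ▸ hfin t ht
  have := hfinite μ (hfin _ (by norm_num))
  have := hfinite ν (hfin' _ (by norm_num))
  have heq : μ.withDensity (fun x => ENNReal.ofReal (Real.exp (-1 * x)))
      = ν.withDensity fun x => ENNReal.ofReal (Real.exp (-1 * x)) := by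
    refine measure_eq_of_mgf_eq_near_zero (Iio_mem_nhds one_pos) (hset μ hfin) (hset ν hfin') ?_
    intro t ht
    unfold ProbabilityTheory.mgf
    rw [integral_eq_lintegral_of_nonneg_ae (ae_of_all _ fun x => Real.exp_nonneg _) (by fun_prop),
      integral_eq_lintegral_of_nonneg_ae (ae_of_all _ fun x => Real.exp_nonneg _) (by fun_prop)]
    simp only [id]
    rw [htilt, htilt, h _ (sub_neg.2 ht)]
  have hpos : ∀ x : ℝ, ENNReal.ofReal (Real.exp (-1 * x)) ≠ 0 := fun x => by
    simp [Real.exp_pos]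
  rw [← withDensity_inv_same (hmeas (-1)) (ae_of_all μ hpos) (ae_of_all μ fun x =>
      ENNReal.ofReal_ne_top), heq, withDensity_inv_same (hmeas (-1)) (ae_of_all ν hpos)
      (ae_of_all ν fun x => ENNReal.ofReal_ne_top)]

theorem integrableOn_exp_sub_one_mul {g : ℝ → ℝ} (hgmeas : Measurable g)
    (hg0 : ∀ x > (0 : ℝ), 0 ≤ g x)
    (hg : IntegrableOn (fun x => min 1 x * g x) (Ioi 0)) {t : ℝ} (ht : t ≤ 0) :
    IntegrableOn (fun x => (Real.exp (t * x) - 1) * g x) (Ioi 0) := by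
  refine (hg.const_mul (1 - t)).mono' (by fun_prop) ?_
  refine (ae_restrict_iff' measurableSet_Ioi).2 (ae_of_all _ fun x (hx : 0 < x) => ?_)
  have hgx := hg0 x hx
  have h1 : Real.exp (t * x) ≤ 1 := Real.exp_le_one_iff.2 (by nlinarith)
  have h2 : 0 < Real.exp (t * x) := Real.exp_pos _
  have h3 := Real.add_one_le_exp (t * x)
  rw [norm_mul, Real.norm_of_nonneg hgx, ← mul_assoc, Real.norm_of_nonpos (by linarith)]
  refine mul_le_mul_of_nonneg_right ?_ hgx
  rcases le_total 1 x with h | h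
  · rw [min_eq_left h]; linarith
  · rw [min_eq_right h]; nlinarith

/-- `∫ (e^{tx} - 1) k(x)/x dx` may be differentiated in `t < 0` under the integral sign. -/
theorem hasDerivAt_integral_exp_sub_one_mul {k : ℝ → ℝ} (hkmeas : Measurable k)
    (hknonneg : ∀ x > (0 : ℝ), 0 ≤ k x)
    (hk : IntegrableOn (fun x => min 1 x * (k x / x)) (Ioi 0)) {t : ℝ} (ht : t < 0) :
    IntegrableOn (fun x => Real.exp (t * x) * k x) (Ioi 0) ∧
    HasDerivAt (fun s => ∫ x in Ioi (0 : ℝ), (Real.exp (s * x) - 1) * (k x / x))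
      (∫ x in Ioi (0 : ℝ), Real.exp (t * x) * k x) t := by
  have hc : 0 < -(t / 2) := by linarith
  refine hasDerivAt_integral_of_dominated_loc_of_deriv_le (s := Iio (t / 2))
    (F := fun s x => (Real.exp (s * x) - 1) * (k x / x))
    (F' := fun s x => Real.exp (s * x) * k x)
    (bound := fun x => (1 + 1 / (-(t / 2))) * (min 1 x * (k x / x)))
    (Iio_mem_nhds (by linarith)) (.of_forall fun s => by fun_prop)
    (integrableOn_exp_sub_one_mul (by fun_prop) (fun x hx => div_nonneg (hknonneg x hx) hx.le) hk
      ht.le) (by fun_prop) ?_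
    (hk.const_mul _) ?_
  · refine (ae_restrict_iff' measurableSet_Ioi).2 (ae_of_all _ fun x (hx : 0 < x) s hs => ?_)
    have hkx : 0 ≤ k x / x := div_nonneg (hknonneg x hx) hx.le
    have hs' : s < t / 2 := hs
    have h1 : Real.exp (s * x) ≤ Real.exp (t / 2 * x) := Real.exp_le_exp.2 (by nlinarith)
    have h0 : Real.exp (t / 2 * x) ≤ 1 := Real.exp_le_one_iff.2 (by nlinarith)
    have h2 : 0 < Real.exp (t / 2 * x) := Real.exp_pos _
    have h3 : -(t / 2) * x * Real.exp (t / 2 * x) ≤ 1 := by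
      have h4 := Real.add_one_le_exp (-(t / 2) * x)
      have h5 : Real.exp (-(t / 2) * x) * Real.exp (t / 2 * x) = 1 := by
        rw [← Real.exp_add]; simp
      nlinarith
    have hC : 0 < 1 / (-(t / 2)) := by positivity
    have h6 : x * Real.exp (t / 2 * x) ≤ 1 / (-(t / 2)) := by
      rw [le_div_iff₀ hc]; linarith
    have h7 : x * Real.exp (t / 2 * x) ≤ (1 + 1 / (-(t / 2))) * min 1 x := by
      rcases le_total 1 x with h | h
      · rw [min_eq_left h]; linarith
      · rw [min_eq_right h]; nlinarith
    rw [Real.norm_of_nonneg (mul_nonneg (Real.exp_nonneg _) (hknonneg x hx))]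
    calc Real.exp (s * x) * k x = x * Real.exp (s * x) * (k x / x) := by field_simp
      _ ≤ x * Real.exp (t / 2 * x) * (k x / x) := by gcongr
      _ ≤ (1 + 1 / (-(t / 2))) * min 1 x * (k x / x) := by gcongr
      _ = _ := by ring
  · refine (ae_restrict_iff' measurableSet_Ioi).2 (ae_of_all _ fun x (hx : 0 < x) s _ => ?_)
    have h := (((hasDerivAt_mul_const (x := s) x).exp.sub_const 1).mul_const (k x / x))
    refine h.congr_deriv ?_
    field_simp

/-- The Steutel equation `x L(dx) = γ L(dx) + (k(x) dx ∗ L)(dx)`. -/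
theorem withDensity_id_eq_smul_add_conv {γ : ℝ} (hγ : 0 ≤ γ) {k : ℝ → ℝ} (hkmeas : Measurable k)
    (hknonneg : ∀ x > (0 : ℝ), 0 ≤ k x)
    (hk : IntegrableOn (fun x => min 1 x * (k x / x)) (Ioi 0))
    {L : Measure ℝ} [IsProbabilityMeasure L] (hL : ∀ᵐ x ∂L, 0 ≤ x)
    (hLap : ∀ t ≤ (0 : ℝ), ∫ x, Real.exp (t * x) ∂L
      = Real.exp (γ * t + ∫ x in Ioi (0 : ℝ), (Real.exp (t * x) - 1) * (k x / x))) :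
    L.withDensity (fun x => ENNReal.ofReal x) = ENNReal.ofReal γ • L +
      L.conv ((volume.restrict (Ioi 0)).withDensity fun x => ENNReal.ofReal (k x)) := by
  have hexp (t : ℝ) : Measurable fun x : ℝ => ENNReal.ofReal (Real.exp (t * x)) := by fun_prop
  have hexpint : ∀ t ≤ (0 : ℝ), Integrable (fun x => Real.exp (t * x)) L := fun t ht => by
    refine (integrable_const (1 : ℝ)).mono' (by fun_prop) ?_
    filter_upwards [hL] with x hx
    rw [Real.norm_of_nonneg (Real.exp_nonneg _), Real.exp_le_one_iff]
    exact mul_nonpos_of_nonpos_of_nonneg ht hx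
  have hint (t : ℝ) (ht : t < 0) :
      t ∈ interior (ProbabilityTheory.integrableExpSet id L) :=
    mem_interior_iff_mem_nhds.2
      (mem_of_superset (Iio_mem_nhds ht) fun s hs => hexpint s (le_of_lt hs))
  have hmoment (t : ℝ) (ht : t < 0) : Integrable (fun x => x * Real.exp (t * x)) L := by
    simpa using ProbabilityTheory.integrable_pow_mul_exp_of_mem_interior_integrableExpSet
      (hint t ht) 1
  have hderiv (t : ℝ) (ht : t < 0) : ∫ x, x * Real.exp (t * x) ∂L
      = (∫ x, Real.exp (t * x) ∂L) * (γ + ∫ x in Ioi (0 : ℝ), Real.exp (t * x) * k x) := by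
    have h1 := ProbabilityTheory.hasDerivAt_mgf (hint t ht)
    have h2 := ((hasDerivAt_const_mul (x := t) γ).add
      (hasDerivAt_integral_exp_sub_one_mul hkmeas hknonneg hk ht).2).exp
    have h3 : ProbabilityTheory.mgf id L =ᶠ[𝓝 t] fun t => Real.exp (γ * t +
        ∫ x in Ioi (0 : ℝ), (Real.exp (t * x) - 1) * (k x / x)) := by
      filter_upwards [Iio_mem_nhds ht] with s hs
      exact hLap s (le_of_lt hs)
    rw [hLap t ht.le]
    exact h1.unique (h2.congr_of_eventuallyEq h3)
  have hA (t : ℝ) (ht : t < 0) :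
      ∫⁻ x, ENNReal.ofReal (Real.exp (t * x)) ∂(L.withDensity fun x => ENNReal.ofReal x)
        = ENNReal.ofReal (∫ x, x * Real.exp (t * x) ∂L) := by
    rw [lintegral_withDensity_eq_lintegral_mul _ (by fun_prop) (hexp t),
      ofReal_integral_eq_lintegral_ofReal (hmoment t ht)]
    · refine lintegral_congr fun x => ?_
      rw [Pi.mul_apply, ENNReal.ofReal_mul' (Real.exp_nonneg _)]
    · filter_upwards [hL] with x hx using mul_nonneg hx (Real.exp_nonneg _)
  refine measure_eq_of_laplace_eq (fun t ht => hA t ht ▸ ENNReal.ofReal_lt_top) fun t ht => ?_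
  have hG : ∫⁻ x, ENNReal.ofReal (Real.exp (t * x))
      ∂((volume.restrict (Ioi 0)).withDensity fun x => ENNReal.ofReal (k x))
        = ENNReal.ofReal (∫ x in Ioi (0 : ℝ), Real.exp (t * x) * k x) := by
    rw [lintegral_withDensity_eq_lintegral_mul _ (by fun_prop) (hexp t),
      ofReal_integral_eq_lintegral_ofReal
        (hasDerivAt_integral_exp_sub_one_mul hkmeas hknonneg hk ht).1]
    · refine lintegral_congr fun x => ?_
      rw [Pi.mul_apply, ENNReal.ofReal_mul (Real.exp_nonneg _), mul_comm]
    · exact (ae_restrict_iff' measurableSet_Ioi).2 (ae_of_all _ fun x hx =>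
        mul_nonneg (Real.exp_nonneg _) (hknonneg x hx))
  have hG0 : 0 ≤ ∫ x in Ioi (0 : ℝ), Real.exp (t * x) * k x :=
    setIntegral_nonneg measurableSet_Ioi fun x hx =>
      mul_nonneg (Real.exp_nonneg _) (hknonneg x hx)
  have hF0 : 0 ≤ ∫ x, Real.exp (t * x) ∂L := integral_nonneg fun x => Real.exp_nonneg _
  have hF : ∫⁻ x, ENNReal.ofReal (Real.exp (t * x)) ∂L
      = ENNReal.ofReal (∫ x, Real.exp (t * x) ∂L) :=
    (ofReal_integral_eq_lintegral_ofReal (hexpint t ht.le)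
      (ae_of_all _ fun x => Real.exp_nonneg _)).symm
  rw [hA t ht, hderiv t ht, lintegral_add_measure, lintegral_smul_measure,
    Measure.lintegral_conv (hexp t)]
  simp_rw [mul_add, Real.exp_add, ENNReal.ofReal_mul (Real.exp_nonneg _)]
  simp_rw [lintegral_const_mul _ (hexp t)]
  rw [lintegral_mul_const _ (hexp t), hG, hF, ENNReal.ofReal_add (mul_nonneg hF0 hγ)
    (mul_nonneg hF0 hG0), ENNReal.ofReal_mul hF0, ENNReal.ofReal_mul hF0, smul_eq_mul,
    mul_comm (ENNReal.ofReal γ)]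

theorem tendsto_exp_integral_of_integrableOn {g : ℝ → ℝ} (hg : IntegrableOn g (Ioi 0)) :
    Tendsto (fun n : ℕ => Real.exp (∫ x in Ioi (0 : ℝ), (Real.exp (-(n : ℝ) * x) - 1) * g x))
      atTop (𝓝 (Real.exp (-∫ x in Ioi (0 : ℝ), g x))) := by
  refine (Real.continuous_exp.tendsto _).comp ?_
  rw [← integral_neg]
  refine tendsto_integral_of_dominated_convergence (fun x => ‖g x‖) (fun n => ?_) hg.norm
    (fun n => ?_) ?_
  · exact (by fun_prop : AEStronglyMeasurable (fun x : ℝ => Real.exp (-(n : ℝ) * x) - 1)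
      (volume.restrict (Ioi 0))).mul hg.1
  · refine (ae_restrict_iff' measurableSet_Ioi).2 (ae_of_all _ fun x (hx : 0 < x) => ?_)
    have h1 : Real.exp (-(n : ℝ) * x) ≤ 1 := Real.exp_le_one_iff.2 (by
      have : (0 : ℝ) ≤ n * x := by positivity
      linarith)
    have h2 := Real.exp_pos (-(n : ℝ) * x)
    rw [norm_mul]
    refine mul_le_of_le_one_left (norm_nonneg _) ?_
    rw [Real.norm_eq_abs, abs_le]
    constructor <;> linarith
  · refine (ae_restrict_iff' measurableSet_Ioi).2 (ae_of_all _ fun x (hx : 0 < x) => ?_)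
    simpa using ((tendsto_exp_neg_nat_mul hx).sub_const 1).mul_const (g x)

theorem tendsto_exp_integral_of_lintegral_eq_top {g : ℝ → ℝ} (hgmeas : Measurable g)
    (hg0 : ∀ x > (0 : ℝ), 0 ≤ g x)
    (hint : ∀ n : ℕ, IntegrableOn (fun x => (Real.exp (-(n : ℝ) * x) - 1) * g x) (Ioi 0))
    (htop : ∫⁻ x in Ioi (0 : ℝ), ENNReal.ofReal (g x) = ⊤) :
    Tendsto (fun n : ℕ => Real.exp (∫ x in Ioi (0 : ℝ), (Real.exp (-(n : ℝ) * x) - 1) * g x))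
      atTop (𝓝 0) := by
  have h1 : Tendsto (fun n : ℕ => ∫⁻ x in Ioi (0 : ℝ),
      ENNReal.ofReal ((1 - Real.exp (-(n : ℝ) * x)) * g x)) atTop (𝓝 ⊤) := by
    rw [← htop]
    refine lintegral_tendsto_of_tendsto_of_monotone (fun n => by fun_prop) ?_ ?_
    · refine (ae_restrict_iff' measurableSet_Ioi).2 (ae_of_all _ fun x (hx : 0 < x) m n hmn => ?_)
      have : (m : ℝ) ≤ n := by exact_mod_cast hmn
      have h2 : Real.exp (-(n : ℝ) * x) ≤ Real.exp (-(m : ℝ) * x) :=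
        Real.exp_le_exp.2 (by nlinarith)
      exact ENNReal.ofReal_le_ofReal
        (mul_le_mul_of_nonneg_right (by linarith) (hg0 x hx))
    · refine (ae_restrict_iff' measurableSet_Ioi).2 (ae_of_all _ fun x (hx : 0 < x) => ?_)
      refine ENNReal.tendsto_ofReal ?_
      simpa using ((tendsto_exp_neg_nat_mul hx).const_sub 1).mul_const (g x)
  refine Real.tendsto_exp_atBot.comp ?_
  rw [← tendsto_neg_atTop_iff]
  refine ENNReal.tendsto_ofReal_nhds_top.1 (h1.congr fun n => ?_)
  rw [← integral_neg, ofReal_integral_eq_lintegral_ofReal (hint n).fun_neg]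
  · exact lintegral_congr fun x => by congr 1; ring
  · refine (ae_restrict_iff' measurableSet_Ioi).2 (ae_of_all _ fun x (hx : 0 < x) => ?_)
    have h2 : Real.exp (-(n : ℝ) * x) ≤ 1 := Real.exp_le_one_iff.2 (by
      have : (0 : ℝ) ≤ n * x := by positivity
      linarith)
    have := mul_nonneg (sub_nonneg.2 h2) (hg0 x hx)
    simp only [Pi.zero_apply]
    linarith

/-- If `L` lives on `[γ, ∞)`, then `e^{γn} ∫ e^{-nx} L(dx)` tends to the mass of `L` at `γ`. -/
theorem tendsto_exp_mul_laplace {L : Measure ℝ} [IsFiniteMeasure L] {γ : ℝ} (hL : L (Iio γ) = 0) :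
    Tendsto (fun n : ℕ => Real.exp (γ * n) * ∫ x, Real.exp (-(n : ℝ) * x) ∂L) atTop
      (𝓝 (L.real {γ})) := by
  have hae : ∀ᵐ x ∂L, γ ≤ x := by
    rw [ae_iff]; simpa [Iio] using hL
  have hlim : Tendsto (fun n : ℕ => ∫ x, Real.exp (-((n : ℝ) * (x - γ))) ∂L) atTop
      (𝓝 (∫ x, ({γ} : Set ℝ).indicator 1 x ∂L)) := by
    refine tendsto_integral_of_dominated_convergence (fun _ => 1) (fun n => by fun_prop)
      (integrable_const _) (fun n => ?_) ?_
    · filter_upwards [hae] with x hx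
      rw [Real.norm_of_nonneg (Real.exp_nonneg _), Real.exp_le_one_iff, neg_nonpos]
      exact mul_nonneg n.cast_nonneg (sub_nonneg.2 hx)
    · filter_upwards [hae] with x hx
      rcases hx.eq_or_lt with rfl | hx
      · simp
      · simpa [hx.ne'] using tendsto_exp_neg_nat_mul (sub_pos.2 hx)
  rw [integral_indicator_one (measurableSet_singleton γ)] at hlim
  refine hlim.congr fun n => ?_
  rw [← integral_const_mul]
  refine integral_congr_ae (ae_of_all _ fun x => ?_)
  simp only [← Real.exp_add]
  congr 1
  ring

/-- If `x L(dx) = γ L(dx) + M(dx)` then `L` has no mass on `(-∞, γ)`. -/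
theorem measure_Iio_eq_zero_of_withDensity_eq {L M : Measure ℝ} [IsFiniteMeasure L] {γ : ℝ}
    (hL : ∀ᵐ x ∂L, 0 ≤ x)
    (h : L.withDensity (fun x => ENNReal.ofReal x) = ENNReal.ofReal γ • L + M) :
    L (Iio γ) = 0 := by
  by_contra hne
  have hlt : ∫⁻ x in Iio γ, ENNReal.ofReal x ∂L < ∫⁻ x in Iio γ, ENNReal.ofReal γ ∂L := by
    refine setLIntegral_strict_mono measurableSet_Iio hne measurable_const ?_ ?_
    · refine ne_top_of_le_ne_top (b := ∫⁻ x in Iio γ, ENNReal.ofReal γ ∂L) ?_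
        (setLIntegral_mono measurable_const fun x hx => ENNReal.ofReal_le_ofReal (le_of_lt hx))
      rw [setLIntegral_const]
      exact ENNReal.mul_ne_top ENNReal.ofReal_ne_top (measure_ne_top _ _)
    · filter_upwards [hL] with x hx hxγ
      exact (ENNReal.ofReal_lt_ofReal_iff (hx.trans_lt hxγ)).2 hxγ
  rw [← withDensity_apply _ measurableSet_Iio, h, setLIntegral_const, Measure.add_apply,
    Measure.smul_apply, smul_eq_mul] at hlt
  exact absurd hlt (not_lt.2 le_self_add)

/-- If `x L(dx) = γ L(dx) + M(dx)` with `M` absolutely continuous, then `L` is absolutely continuous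
off `γ`. -/
theorem restrict_compl_singleton_absolutelyContinuous_of_withDensity_eq {L M ρ : Measure ℝ}
    [IsFiniteMeasure L] {γ : ℝ} (hγ : 0 ≤ γ) (hL : ∀ᵐ x ∂L, 0 ≤ x) (hM : M ≪ ρ)
    (h : L.withDensity (fun x => ENNReal.ofReal x) = ENNReal.ofReal γ • L + M) :
    L.restrict {γ}ᶜ ≪ ρ := by
  have hIio := measure_Iio_eq_zero_of_withDensity_eq hL h
  refine Measure.AbsolutelyContinuous.mk fun s hs hs0 => ?_
  rw [Measure.restrict_apply hs]
  have hsub : s ∩ {γ}ᶜ ⊆ Iio γ ∪ s ∩ Ioi γ := fun x hx =>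
    (lt_or_gt_of_ne hx.2).imp id fun hlt => ⟨hx.1, hlt⟩
  refine measure_mono_null hsub (measure_union_null hIio ?_)
  by_contra hne
  have hsm : MeasurableSet (s ∩ Ioi γ) := hs.inter measurableSet_Ioi
  have hlt : ∫⁻ x in s ∩ Ioi γ, ENNReal.ofReal γ ∂L < ∫⁻ x in s ∩ Ioi γ, ENNReal.ofReal x ∂L := by
    refine setLIntegral_strict_mono hsm hne (by fun_prop) ?_ (ae_of_all _ fun x hx => ?_)
    · rw [setLIntegral_const]
      exact ENNReal.mul_ne_top ENNReal.ofReal_ne_top (measure_ne_top _ _)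
    · have hx' : γ < x := hx.2
      exact (ENNReal.ofReal_lt_ofReal_iff (hγ.trans_lt hx')).2 hx'
  have hM0 : M (s ∩ Ioi γ) = 0 := measure_mono_null inter_subset_left (hM hs0)
  rw [setLIntegral_const, ← withDensity_apply _ hsm, h, Measure.add_apply, Measure.smul_apply,
    smul_eq_mul, hM0, add_zero] at hlt
  exact lt_irrefl _ hlt

/-- Let `L` be a probability measure on `[0,∞)` with Laplace transform
`∫ e^{−ux} dL(x) = exp(−γu + ∫_0^∞ (e^{−ux} − 1) k(x)/x dx)` for all `u ≥ 0`, where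
`γ ≥ 0` and `k : (0,∞) → [0,∞)` is Borel with `∫_0^∞ min(1,x) k(x)/x dx < ∞`.
If `∫_0^1 k(x)/x dx = ∞` then `L` is absolutely continuous w.r.t. Lebesgue measure;
if `∫_0^1 k(x)/x dx < ∞` then `L` has an atom at `γ` of mass
`exp(−∫_0^∞ k(x)/x dx) > 0` and `L` restricted to `ℝ \ {γ}` is absolutely continuous
w.r.t. Lebesgue measure. -/
theorem stmt13 (γ : ℝ) (hγ : 0 ≤ γ) (k : ℝ → ℝ) (hkmeas : Measurable k)
    (hknonneg : ∀ x > (0:ℝ), 0 ≤ k x)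
    (hkint : ∫⁻ x in Set.Ioi (0:ℝ), ENNReal.ofReal (min 1 x * (k x / x)) < ⊤)
    (L : Measure ℝ) [IsProbabilityMeasure L] (hLsupp : L (Set.Iio 0) = 0)
    (hLap : ∀ u ≥ (0:ℝ),
      ∫ x, Real.exp (-(u * x)) ∂L
        = Real.exp (-(γ * u) +
            ∫ x in Set.Ioi (0:ℝ), (Real.exp (-(u * x)) - 1) * (k x / x))) :
    ((∫⁻ x in Set.Ioc (0:ℝ) 1, ENNReal.ofReal (k x / x) = ⊤) →
      L ≪ MeasureTheory.volume) ∧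
    ((∫⁻ x in Set.Ioc (0:ℝ) 1, ENNReal.ofReal (k x / x) < ⊤) →
      L {γ} = ENNReal.ofReal (Real.exp (-(∫ x in Set.Ioi (0:ℝ), k x / x))) ∧
      0 < L {γ} ∧
      L.restrict ({γ}ᶜ) ≪ MeasureTheory.volume) := by
  have hk : IntegrableOn (fun x => min 1 x * (k x / x)) (Ioi 0) := by
    refine ⟨by fun_prop, ?_⟩
    rw [hasFiniteIntegral_iff_ofReal]
    · exact hkint
    · refine (ae_restrict_iff' measurableSet_Ioi).2 (ae_of_all _ fun x (hx : 0 < x) => ?_)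
      exact mul_nonneg (le_min zero_le_one hx.le) (div_nonneg (hknonneg x hx) hx.le)
  have hL : ∀ᵐ x ∂L, 0 ≤ x := by
    rw [ae_iff]; simpa [Iio] using hLsupp
  have hLap' : ∀ t ≤ (0 : ℝ), ∫ x, Real.exp (t * x) ∂L
      = Real.exp (γ * t + ∫ x in Ioi (0 : ℝ), (Real.exp (t * x) - 1) * (k x / x)) :=
    fun t ht => by simpa using hLap (-t) (neg_nonneg.2 ht)
  have hsteutel := withDensity_id_eq_smul_add_conv hγ hkmeas hknonneg hk hL hLap'
  have hac : L.restrict {γ}ᶜ ≪ volume :=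
    restrict_compl_singleton_absolutelyContinuous_of_withDensity_eq hγ hL
      (Measure.conv_absolutelyContinuous
        ((withDensity_absolutelyContinuous _ _).trans Measure.restrict_le_self.absolutelyContinuous))
      hsteutel
  have hatom : Tendsto (fun n : ℕ => Real.exp
      (∫ x in Ioi (0 : ℝ), (Real.exp (-(n : ℝ) * x) - 1) * (k x / x))) atTop
      (𝓝 (L.real {γ})) := by
    refine (tendsto_exp_mul_laplace (measure_Iio_eq_zero_of_withDensity_eq hL hsteutel)).congr
      fun n => ?_
    rw [hLap' (-n) (by simp), ← Real.exp_add]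
    congr 1
    ring
  have hkx0 : ∀ x > (0 : ℝ), 0 ≤ k x / x := fun x hx => div_nonneg (hknonneg x hx) hx.le
  refine ⟨fun htop => ?_, fun hfin => ?_⟩
  · have hzero : L.real {γ} = 0 := by
      refine tendsto_nhds_unique hatom (tendsto_exp_integral_of_lintegral_eq_top (by fun_prop) hkx0
        (fun n => integrableOn_exp_sub_one_mul (by fun_prop) hkx0 hk (by simp)) ?_)
      exact top_le_iff.1 (htop ▸ lintegral_mono_set Ioc_subset_Ioi_self)
    rw [measureReal_eq_zero_iff] at hzero
    rwa [Measure.restrict_eq_self_of_ae_mem] at hac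
    rw [ae_iff]
    simpa using hzero
  · have hint : IntegrableOn (fun x => k x / x) (Ioi 0) := by
      rw [← Ioc_union_Ioi_eq_Ioi zero_le_one]
      refine IntegrableOn.union ⟨(hkmeas.div measurable_id).aestronglyMeasurable, ?_⟩ ?_
      · rwa [hasFiniteIntegral_iff_ofReal]
        exact (ae_restrict_iff' measurableSet_Ioc).2 (ae_of_all _ fun x hx => hkx0 x hx.1)
      · refine (hk.mono_set (Ioi_subset_Ioi zero_le_one)).congr_fun (fun x (hx : 1 < x) => ?_)
          measurableSet_Ioi
        simp [min_eq_left hx.le]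
    have hmass : L {γ} = ENNReal.ofReal (Real.exp (-(∫ x in Ioi (0 : ℝ), k x / x))) := by
      rw [← tendsto_nhds_unique hatom (tendsto_exp_integral_of_integrableOn hint),
        ofReal_measureReal]
    exact ⟨hmass, hmass ▸ ENNReal.ofReal_pos.2 (Real.exp_pos _), hac⟩
end
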